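/- arXiv:1305.1017 — 6 statements merged into one kernel-verified Lean document; each statement's English description precedes it below -/
import Mathlib

section
/- Let q, d, m ≥ 2 and let a, j be integers with 0 ≤ a < d and 0 ≤ j < m. If gcd(m, q−1) = 1, then there is a constant C > 0 (depending only on q) such that for all N ≥ 1, |#{0 ≤ n < N : n ≡ a (mod d) and s_q(n) ≡ j (mod m)} − N/(dm)| ≤ C·N^λ, where λ = (1/(2·log q))·log( q·sin(π/(2m)) / sin(π/(2mq)) ); moreover λ < 1. -/
open Real Finset

namespace Gelfond

/-- The twisted digit sum `∑_{n < N} z ^ s_q(n) * w ^ n`. -/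
noncomputable def digitSum (q : ℕ) (z w : ℂ) (N : ℕ) : ℂ :=
  ∑ n ∈ range N, z ^ (Nat.digits q n).sum * w ^ n

/-! ### Ratios of sines -/

lemma sin_nat_mul_mul_sin_le {s t : ℝ} (ht : 0 < t) (hts : t ≤ s) (n : ℕ) (hn : n * s ≤ π / 2)
    (hs : s ≤ π / 2) :
    sin (n * s) * sin t ≤ sin (n * t) * sin s := by
  induction n with
  | zero => simp
  | succ n ih =>
    push_cast at hn ⊢
    have hn0 : (0 : ℝ) ≤ n := n.cast_nonneg
    have hpi := pi_pos
    have hns : n * s ≤ π / 2 := by linarith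
    have hnt : n * t ≤ n * s := by gcongr
    have h0nt : 0 ≤ n * t := by positivity
    have hsin_s : 0 ≤ sin s := sin_nonneg_of_nonneg_of_le_pi (by linarith) (by linarith)
    have hsin_t : 0 ≤ sin t := sin_nonneg_of_nonneg_of_le_pi (by linarith) (by linarith)
    have hsin_nt : 0 ≤ sin (n * t) := sin_nonneg_of_nonneg_of_le_pi (by linarith) (by linarith)
    have hcos_s : 0 ≤ cos s := cos_nonneg_of_neg_pi_div_two_le_of_le (by linarith) hs
    have hcos : cos s ≤ cos t := cos_le_cos_of_nonneg_of_le_pi ht.le (by linarith) hts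
    have hcos_n : cos (n * s) ≤ cos (n * t) :=
      cos_le_cos_of_nonneg_of_le_pi h0nt (by linarith) hnt
    rw [add_mul, add_mul, one_mul, one_mul, sin_add, sin_add]
    have h1 := mul_le_mul_of_nonneg_right (ih hns) hcos_s
    have h2 := mul_le_mul_of_nonneg_left hcos (mul_nonneg hsin_nt hsin_s)
    have h3 := mul_le_mul_of_nonneg_right hcos_n (mul_nonneg hsin_s hsin_t)
    linarith

lemma sin_nat_mul_lt {t : ℝ} (ht : 0 < t) {n : ℕ} (hn : 2 ≤ n) (hnt : n * t ≤ π / 2) :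
    sin (n * t) < n * sin t := by
  induction n, hn using Nat.le_induction with
  | base =>
    push_cast at hnt ⊢
    have hsin : 0 < sin t := sin_pos_of_pos_of_lt_pi ht (by linarith)
    have hcos : cos t < 1 := by
      have := cos_lt_cos_of_nonneg_of_le_pi le_rfl (by linarith : t ≤ π) ht
      simpa using this
    rw [sin_two_mul]
    nlinarith
  | succ n hn ih =>
    push_cast at hnt ⊢
    have hn0 : (2 : ℝ) ≤ n := by exact_mod_cast hn
    have htpi : t ≤ π / 2 := by nlinarith
    have h0 : 0 ≤ n * t := by positivity
    have hsin : 0 < sin t := sin_pos_of_pos_of_lt_pi ht (by linarith)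
    have hsin_n : 0 ≤ sin (n * t) := sin_nonneg_of_nonneg_of_le_pi h0 (by linarith)
    have := ih (by linarith)
    rw [add_mul, one_mul, sin_add]
    nlinarith [cos_le_one t, cos_le_one (n * t)]

lemma abs_sin_nat_mul_mul_sin_le {q : ℕ} (hq : 1 ≤ q) {t s : ℝ} (ht : 0 < t)
    (hqt : q * t ≤ π / 2) (hts : t ≤ s) (hs : s ≤ π / 2) :
    |sin (q * s)| * sin t ≤ sin (q * t) * sin s := by
  have hq1 : (1 : ℝ) ≤ q := by exact_mod_cast hq
  have hpi := pi_pos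
  have ht0 : 0 ≤ sin t := sin_nonneg_of_nonneg_of_le_pi ht.le (by linarith)
  rcases le_total (q * s) (π / 2) with h | h
  · rw [abs_of_nonneg (sin_nonneg_of_nonneg_of_le_pi (by nlinarith) (by linarith))]
    exact sin_nat_mul_mul_sin_le ht hts q h hs
  · have hqc : q * (π / (2 * q)) = π / 2 := by field_simp
    have hc : t ≤ π / (2 * q) := by
      rw [le_div_iff₀ (by positivity)]; linarith
    have hcs : π / (2 * q) ≤ s := by
      rw [div_le_iff₀ (by positivity)]; linarith
    have hkey := sin_nat_mul_mul_sin_le ht hc q hqc.le (hcs.trans hs)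
    rw [hqc, sin_pi_div_two, one_mul] at hkey
    have hsin_qt : 0 ≤ sin (q * t) :=
      sin_nonneg_of_nonneg_of_le_pi (by positivity) (by linarith)
    calc |sin (q * s)| * sin t ≤ 1 * sin t := by gcongr; exact abs_sin_le_one _
      _ = sin t := one_mul _
      _ ≤ sin (q * t) * sin (π / (2 * q)) := hkey
      _ ≤ sin (q * t) * sin s := by
        gcongr
        exact sin_le_sin_of_le_of_le_pi_div_two (by linarith [ht.le.trans hc]) hs hcs

/-! ### Geometric sums on the unit circle -/

lemma norm_geom_sum_exp_mul (q : ℕ) (t : ℝ) :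
    ‖∑ b ∈ range q, Complex.exp (Complex.I * (2 * t : ℝ)) ^ b‖ * |sin t| = |sin (q * t)| := by
  have h := congrArg norm (geom_sum_mul (Complex.exp (Complex.I * (2 * t : ℝ))) q)
  have hpow : Complex.exp (Complex.I * (2 * t : ℝ)) ^ q
      = Complex.exp (Complex.I * (2 * (q * t) : ℝ)) := by
    rw [← Complex.exp_nat_mul]; congr 1; push_cast; ring
  rw [norm_mul, hpow, Complex.norm_exp_I_mul_ofReal_sub_one,
    Complex.norm_exp_I_mul_ofReal_sub_one, mul_div_cancel_left₀ _ two_ne_zero,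
    mul_div_cancel_left₀ _ two_ne_zero, norm_mul, norm_mul] at h
  simp only [Real.norm_eq_abs, abs_two] at h
  linarith

lemma norm_geom_sum_le {q : ℕ} {u : ℂ} (hu : ‖u‖ = 1) : ‖∑ b ∈ range q, u ^ b‖ ≤ q :=
  (norm_sum_le _ _).trans (by simp [hu])

/-- Away from the integers the geometric sum is bounded by its value at distance `δ`. -/
lemma norm_geom_sum_exp_le {q : ℕ} (hq : 1 ≤ q) {δ : ℝ} (hδ : 0 < δ) (hqδ : q * δ ≤ 1 / 2)
    {x : ℝ} (hx : ∀ n : ℤ, δ ≤ |x - n|) :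
    ‖∑ b ∈ range q, Complex.exp (Complex.I * (2 * (π * x) : ℝ)) ^ b‖
      ≤ sin (q * (π * δ)) / sin (π * δ) := by
  have hpi := pi_pos
  have hq1 : (1 : ℝ) ≤ q := by exact_mod_cast hq
  have hper : Complex.exp (Complex.I * (2 * (π * x) : ℝ))
      = Complex.exp (Complex.I * (2 * (π * (x - round x)) : ℝ)) := by
    rw [Complex.exp_eq_exp_iff_exists_int]
    exact ⟨round x, by push_cast; ring⟩
  set y := x - round x with hy
  have hyδ : δ ≤ |y| := hx _
  have hyh : |y| ≤ 1 / 2 := abs_sub_round x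
  have hδh : δ ≤ 1 / 2 := hyδ.trans hyh
  have hsinδ : 0 < sin (π * δ) := sin_pos_of_pos_of_lt_pi (by positivity) (by nlinarith)
  have hsiny : 0 < sin (π * |y|) :=
    sin_pos_of_pos_of_lt_pi (mul_pos hpi (hδ.trans_le hyδ)) (by nlinarith)
  have habs : |sin (π * y)| = sin (π * |y|) ∧ |sin (q * (π * y))| = |sin (q * (π * |y|))| := by
    rcases abs_choice y with h | h <;> rw [h] at hsiny ⊢
    · exact ⟨abs_of_pos hsiny, rfl⟩
    · constructor
      · rw [← abs_neg, ← sin_neg, ← mul_neg, abs_of_pos hsiny]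
      · rw [mul_neg, mul_neg, sin_neg, abs_neg]
  have hnorm := norm_geom_sum_exp_mul q (π * y)
  rw [habs.1, habs.2] at hnorm
  rw [hper, le_div_iff₀ hsinδ]
  refine le_of_mul_le_mul_right ?_ hsiny
  rw [mul_right_comm, hnorm]
  exact abs_sin_nat_mul_mul_sin_le hq (by positivity) (by nlinarith) (by gcongr) (by nlinarith)

/-- The product of two consecutive factors of the exponential sum is at most
`q sin(π/2m) / sin(π/2mq)`. -/
lemma norm_geom_sum_mul_le {q m : ℕ} (hq : 2 ≤ q) (hm : 2 ≤ m) {z w : ℂ} (hz : z ^ m = 1)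
    (hzq : z ^ (q - 1) ≠ 1) (hw : ‖w‖ = 1) :
    ‖∑ b ∈ range q, (z * w) ^ b‖ * ‖∑ b ∈ range q, (z * w ^ q) ^ b‖
      ≤ q * sin (π / (2 * m)) / sin (π / (2 * m * q)) := by
  have hpi := pi_pos
  have hq2 : (2 : ℝ) ≤ q := by exact_mod_cast hq
  have hm2 : (2 : ℝ) ≤ m := by exact_mod_cast hm
  have hz1 : ‖z‖ = 1 := Complex.norm_eq_one_of_pow_eq_one hz (by lia)
  have hprim := Complex.isPrimitiveRoot_exp m (by lia)
  have : NeZero m := ⟨by lia⟩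
  obtain ⟨k, -, hk⟩ := hprim.eq_pow_of_pow_eq_one hz
  obtain ⟨θ, hθ⟩ := (Complex.norm_eq_one_iff w).1 hw
  have hndvd : ¬ m ∣ k * (q - 1) := fun h => hzq (by
    rw [← hk, ← pow_mul]; exact (hprim.pow_eq_one_iff_dvd _).2 h)
  have hzk : z = Complex.exp (Complex.I * (2 * (π * (k / m)) : ℝ)) := by
    rw [← hk, ← Complex.exp_nat_mul]; congr 1; push_cast; ring
  set x : ℝ := k / m + θ / (2 * π) with hx
  set y : ℝ := k / m + q * (θ / (2 * π)) with hy
  have hxe : z * w = Complex.exp (Complex.I * (2 * (π * x) : ℝ)) := by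
    rw [hzk, ← hθ, ← Complex.exp_add]; congr 1
    rw [hx]; push_cast
    have : (π : ℂ) ≠ 0 := by exact_mod_cast hpi.ne'
    field_simp
  have hye : z * w ^ q = Complex.exp (Complex.I * (2 * (π * y) : ℝ)) := by
    rw [hzk, ← hθ, ← Complex.exp_nat_mul, ← Complex.exp_add]; congr 1
    rw [hy]; push_cast
    have : (π : ℂ) ≠ 0 := by exact_mod_cast hpi.ne'
    field_simp
  have hδ : (0 : ℝ) < 1 / (2 * m * q) := by positivity
  have hqδ : (q : ℝ) * (1 / (2 * m * q)) = 1 / (2 * m) := by field_simp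
  have hqδ' : (q : ℝ) * (1 / (2 * m * q)) ≤ 1 / 2 := by
    rw [hqδ]; gcongr; linarith
  have hbound : sin (q * (π * (1 / (2 * m * q)))) / sin (π * (1 / (2 * m * q)))
      = sin (π / (2 * m)) / sin (π / (2 * m * q)) := by
    rw [mul_left_comm, hqδ, mul_one_div, mul_one_div]
  have hux : ‖z * w‖ = 1 := by simp [hz1, hw]
  have huy : ‖z * w ^ q‖ = 1 := by simp [hz1, hw]
  rw [mul_div_assoc, ← hbound]
  by_cases hcase : ∀ n : ℤ, 1 / (2 * m * q) ≤ |y - n|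
  · have := norm_geom_sum_exp_le (by lia) hδ hqδ' hcase
    rw [← hye] at this
    exact mul_le_mul (norm_geom_sum_le hux) this (norm_nonneg _) (by positivity)
  · push Not at hcase
    obtain ⟨n, hn⟩ := hcase
    have hxn : ∀ l : ℤ, 1 / (2 * m * q) ≤ |x - l| := by
      by_contra! hcon
      obtain ⟨l, hl⟩ := hcon
      have h1 : |q * x - q * l| < 1 / (2 * m) := by
        rw [← mul_sub, abs_mul, Nat.abs_cast, ← hqδ]
        gcongr
      have h2 : |y - n| < 1 / (2 * m) := hn.trans_le
        (one_div_le_one_div_of_le (by positivity) (by nlinarith))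
      have h3 : |(k * (q - 1) - m * (q * l - n) : ℝ)| < 1 := by
        have e : (k * (q - 1) - m * (q * l - n) : ℝ) = m * ((q * x - q * l) - (y - n)) := by
          rw [hx, hy]; field_simp; ring
        rw [e, abs_mul, Nat.abs_cast]
        calc (m : ℝ) * |(q * x - q * l) - (y - n)|
            ≤ m * (|q * x - q * l| + |y - n|) := by gcongr; exact abs_sub _ _
          _ < m * (1 / (2 * m) + 1 / (2 * m)) := by gcongr
          _ = 1 := by field_simp; norm_num
      have h4 : |(k * (q - 1) - m * (q * l - n) : ℤ)| < 1 := by exact_mod_cast h3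
      rw [Int.abs_lt_one_iff, sub_eq_zero] at h4
      apply hndvd
      have h5 : (m : ℤ) ∣ ((k * (q - 1) : ℕ) : ℤ) := by
        rw [Nat.cast_mul, Nat.cast_sub (by lia), Nat.cast_one, h4]
        exact dvd_mul_right _ _
      exact_mod_cast h5
    have := norm_geom_sum_exp_le (by lia) hδ hqδ' hxn
    rw [← hxe] at this
    rw [mul_comm]
    exact mul_le_mul (norm_geom_sum_le huy) this (norm_nonneg _) (by positivity)

/-! ### The twisted digit sum -/

lemma sum_digits_mul_add {q : ℕ} (hq : 2 ≤ q) (n : ℕ) {b : ℕ} (hb : b < q) :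
    (Nat.digits q (q * n + b)).sum = b + (Nat.digits q n).sum := by
  by_cases h : b ≠ 0 ∨ n ≠ 0
  · rw [add_comm, Nat.digits_add q (by lia) b n hb h, List.sum_cons]
  · push Not at h
    simp [h.1, h.2]

lemma digitSum_mul {q : ℕ} (hq : 2 ≤ q) (z w : ℂ) (M : ℕ) :
    digitSum q z w (q * M) = (∑ b ∈ range q, (z * w) ^ b) * digitSum q z (w ^ q) M := by
  unfold digitSum
  induction M with
  | zero => simp
  | succ M ih =>
    rw [mul_add_one, sum_range_add, ih, sum_range_succ _ M, mul_add, sum_mul _ _ (_ * _)]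
    congr 1
    refine sum_congr rfl fun b hb => ?_
    rw [sum_digits_mul_add hq M (mem_range.1 hb)]
    ring

lemma norm_digitSum_add_le (q : ℕ) {z w : ℂ} (hz : ‖z‖ = 1) (hw : ‖w‖ = 1) (M r : ℕ) :
    ‖digitSum q z w (M + r)‖ ≤ ‖digitSum q z w M‖ + r := by
  unfold digitSum
  rw [sum_range_add]
  refine (norm_add_le _ _).trans ?_
  gcongr
  exact (norm_sum_le _ _).trans (by simp [hz, hw])

lemma norm_digitSum_le {q m : ℕ} (hq : 2 ≤ q) (hm : 2 ≤ m) {z : ℂ} (hz : z ^ m = 1)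
    (hzq : z ^ (q - 1) ≠ 1) {c : ℝ} (hc : 0 ≤ c)
    (hR : q * sin (π / (2 * m)) / sin (π / (2 * m * q)) ≤ (q ^ 2 : ℝ) ^ c)
    (hqR : 2 ≤ (q ^ 2 : ℝ) ^ c) (N : ℕ) (hN : 1 ≤ N) (w : ℂ) (hw : ‖w‖ = 1) :
    ‖digitSum q z w N‖ ≤ 2 * q ^ 2 * (N : ℝ) ^ c - q ^ 2 := by
  have hz1 : ‖z‖ = 1 := Complex.norm_eq_one_of_pow_eq_one hz (by lia)
  induction N using Nat.strong_induction_on generalizing w with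
  | _ N ih =>
  have hdecomp : q ^ 2 * (N / q ^ 2) + N % q ^ 2 = N := Nat.div_add_mod _ _
  have hr : N % q ^ 2 < q ^ 2 := Nat.mod_lt _ (by positivity)
  have hr' : ((N % q ^ 2 : ℕ) : ℝ) ≤ q ^ 2 := by exact_mod_cast hr.le
  set M := N / q ^ 2
  set r := N % q ^ 2
  have hle := norm_digitSum_add_le q hz1 hw (q ^ 2 * M) r
  rw [hdecomp] at hle
  have hN1 : (1 : ℝ) ≤ (N : ℝ) ^ c := one_le_rpow (by exact_mod_cast hN) hc
  have hq0 : (0 : ℝ) ≤ q ^ 2 := by positivity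
  rcases Nat.eq_zero_or_pos M with hM | hM
  · rw [hM] at hle
    simp only [mul_zero, digitSum, range_zero, sum_empty, norm_zero, zero_add] at hle
    rw [digitSum]
    nlinarith
  · have hMN : M < N := Nat.div_lt_self (by lia) (Nat.one_lt_pow (by lia) (by lia))
    have hIH := ih M hMN hM (w ^ q ^ 2) (by simp [hw])
    have hfac : ‖digitSum q z w (q ^ 2 * M)‖
        ≤ (q ^ 2 : ℝ) ^ c * (2 * q ^ 2 * (M : ℝ) ^ c - q ^ 2) := by
      rw [pow_two, mul_assoc, digitSum_mul hq, digitSum_mul hq, ← pow_mul, ← mul_assoc, norm_mul,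
        norm_mul, ← pow_two]
      exact mul_le_mul ((norm_geom_sum_mul_le hq hm hz hzq hw).trans hR) hIH (norm_nonneg _)
        (by positivity)
    have hpow : (q ^ 2 : ℝ) ^ c * (M : ℝ) ^ c ≤ (N : ℝ) ^ c := by
      rw [← mul_rpow (by positivity) (by positivity)]
      refine rpow_le_rpow (by positivity) ?_ hc
      have : q ^ 2 * M ≤ N := by lia
      exact_mod_cast this
    nlinarith

/-! ### Detecting residue classes with roots of unity -/

lemma sum_primitiveRoot_pow_eq_ite {ζ : ℂ} {d : ℕ} (hζ : IsPrimitiveRoot ζ d) {a : ℕ}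
    (ha : a < d) (n : ℕ) :
    ∑ l ∈ range d, (ζ ^ l) ^ n * (ζ ^ l) ^ (d - a) = if n % d = a then (d : ℂ) else 0 := by
  have hterm : ∀ l, (ζ ^ l) ^ n * (ζ ^ l) ^ (d - a) = (ζ ^ (n + (d - a))) ^ l := fun l => by
    rw [← pow_add, ← pow_mul, ← pow_mul, mul_comm]
  simp only [hterm]
  have hiff : n % d = a ↔ d ∣ n + (d - a) := by
    constructor
    · intro h
      refine ⟨n / d + 1, ?_⟩
      have := Nat.div_add_mod n d
      rw [mul_add_one]
      lia
    · intro h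
      have h1 : (n + (d - a) + a) % d = a := by
        rw [Nat.add_mod, Nat.mod_eq_zero_of_dvd h, zero_add, Nat.mod_mod, Nat.mod_eq_of_lt ha]
      rwa [add_assoc, Nat.sub_add_cancel ha.le, Nat.add_mod_right] at h1
  split_ifs with h
  · simp [(hζ.pow_eq_one_iff_dvd _).2 (hiff.1 h)]
  · have hne : ζ ^ (n + (d - a)) ≠ 1 := fun h1 =>
      h (hiff.2 ((hζ.pow_eq_one_iff_dvd _).1 h1))
    refine (mul_eq_zero.1 ?_).resolve_right (sub_ne_zero.2 hne)
    rw [geom_sum_mul, ← pow_mul, mul_comm, pow_mul, hζ.pow_eq_one, one_pow, sub_self]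

lemma abs_card_filter_mod_sub_le {d a : ℕ} (ha : a < d) (N : ℕ) :
    |(((range N).filter (fun n => n % d = a)).card : ℝ) - N / d| ≤ 1 := by
  have hd : 0 < d := by lia
  have hcount : ((range N).filter (fun n => n % d = a)).card
      = N / d + if a < N % d then 1 else 0 := by
    have := Nat.count_modEq_card N hd a
    rw [Nat.mod_eq_of_lt ha, Nat.count_eq_card_filter_range] at this
    rw [← this]
    congr 1
    ext n
    simp [Nat.ModEq, Nat.mod_eq_of_lt ha]
  have hd0 : (0 : ℝ) < d := by exact_mod_cast hd
  have h1 : ((N / d : ℕ) : ℝ) ≤ N / d := Nat.cast_div_le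
  have h2 : (N : ℝ) / d < (N / d : ℕ) + 1 := by
    rw [div_lt_iff₀ hd0]
    exact_mod_cast Nat.lt_mul_of_div_lt (Nat.lt_succ_self _) hd
  rw [hcount, abs_le]
  split_ifs <;> push_cast <;> constructor <;> linarith

/-- A uniform bound for the nontrivial twisted sums gives equidistribution. -/
lemma abs_card_sub_le {q d m a j N : ℕ} (ha : a < d) (hj : j < m) {B : ℝ}
    (hB : ∀ z w : ℂ, z ^ m = 1 → z ≠ 1 → ‖w‖ = 1 → ‖digitSum q z w N‖ ≤ B) (hB0 : 0 ≤ B) :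
    |((((range N).filter (fun n => n % d = a ∧ (Nat.digits q n).sum % m = j)).card : ℝ)
      - (N : ℝ) / (d * m))| ≤ B + 1 := by
  have hζ := Complex.isPrimitiveRoot_exp d (by lia)
  have hω := Complex.isPrimitiveRoot_exp m (by lia)
  set ζ := Complex.exp (2 * π * Complex.I / d)
  set ω := Complex.exp (2 * π * Complex.I / m)
  have hζ1 : ‖ζ‖ = 1 := Complex.norm_eq_one_of_pow_eq_one hζ.pow_eq_one (by lia)
  have hω1 : ‖ω‖ = 1 := Complex.norm_eq_one_of_pow_eq_one hω.pow_eq_one (by lia)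
  have hd0 : (0 : ℝ) < d := by exact_mod_cast (by lia : 0 < d)
  have hm0 : (0 : ℝ) < m := by exact_mod_cast (by lia : 0 < m)
  set A := ((range N).filter (fun n => n % d = a ∧ (Nat.digits q n).sum % m = j)).card with hA
  set A₀ := ((range N).filter (fun n => n % d = a)).card with hA₀
  set T : ℕ → ℂ := fun k => ∑ l ∈ range d,
    (ω ^ k) ^ (m - j) * (ζ ^ l) ^ (d - a) * digitSum q (ω ^ k) (ζ ^ l) N with hT
  have hTsum : ∑ k ∈ range m, T k = d * m * A := by
    have : ∀ n, (if n % d = a then (d : ℂ) else 0)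
        * (if (Nat.digits q n).sum % m = j then (m : ℂ) else 0)
        = if n % d = a ∧ (Nat.digits q n).sum % m = j then (d * m : ℂ) else 0 := fun n => by
      split_ifs <;> simp_all
    have hrhs : (d * m * A : ℂ) = ∑ n ∈ range N, (if n % d = a then (d : ℂ) else 0)
        * (if (Nat.digits q n).sum % m = j then (m : ℂ) else 0) := by
      simp only [this]
      rw [← sum_filter, sum_const, nsmul_eq_mul, ← hA, mul_comm]
    rw [hrhs]
    simp only [← sum_primitiveRoot_pow_eq_ite hζ ha, ← sum_primitiveRoot_pow_eq_ite hω hj]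
    simp only [sum_mul_sum]
    simp only [hT, digitSum, mul_sum]
    rw [sum_comm (s := range N), sum_comm (s := range m)]
    refine sum_congr rfl fun l _ => ?_
    rw [sum_comm (s := range m)]
    refine sum_congr rfl fun n _ => sum_congr rfl fun k _ => ?_
    ring
  have hT0 : T 0 = d * A₀ := by
    have hrhs : (d * A₀ : ℂ) = ∑ n ∈ range N, (if n % d = a then (d : ℂ) else 0) := by
      rw [← sum_filter, sum_const, nsmul_eq_mul, ← hA₀, mul_comm]
    rw [hrhs]
    simp only [← sum_primitiveRoot_pow_eq_ite hζ ha, hT, digitSum, mul_sum, pow_zero, one_pow,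
      one_mul]
    rw [sum_comm]
    refine sum_congr rfl fun n _ => sum_congr rfl fun l _ => ?_
    ring
  have hTk : ∀ k ∈ Ico 1 m, ‖T k‖ ≤ d * B := fun k hk => by
    obtain ⟨hk1, hkm⟩ := mem_Ico.1 hk
    have hkne : ω ^ k ≠ 1 := hω.pow_ne_one_of_pos_of_lt (by lia) hkm
    have hkm1 : (ω ^ k) ^ m = 1 := by rw [← pow_mul, mul_comm, pow_mul, hω.pow_eq_one, one_pow]
    refine (norm_sum_le_of_le _ (n := fun _ => B) fun l _ => ?_).trans (by simp)
    rw [norm_mul, norm_mul]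
    simpa [hω1, hζ1] using hB (ω ^ k) (ζ ^ l) hkm1 hkne (by simp [hζ1])
  have hdiff : |(d * m * A - d * A₀ : ℝ)| ≤ m * (d * B) := by
    have e : ((d * m * A - d * A₀ : ℝ) : ℂ) = ∑ k ∈ Ico 1 m, T k := by
      rw [range_eq_Ico, sum_eq_sum_Ico_succ_bot (by lia), hT0] at hTsum
      push_cast
      rw [← hTsum]
      ring
    rw [← Real.norm_eq_abs, ← Complex.norm_real, e]
    refine (norm_sum_le_of_le _ hTk).trans ?_
    rw [sum_const, Nat.card_Ico, nsmul_eq_mul]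
    gcongr
    lia
  have h1 : |(A : ℝ) - A₀ / m| ≤ B := by
    have e : (A : ℝ) - A₀ / m = (d * m * A - d * A₀) / (d * m) := by field_simp
    rw [e, abs_div, abs_of_pos (mul_pos hd0 hm0), div_le_iff₀ (mul_pos hd0 hm0)]
    linarith
  have h2 : |(A₀ : ℝ) / m - N / (d * m)| ≤ 1 := by
    have e : (A₀ : ℝ) / m - N / (d * m) = (A₀ - N / d) / m := by field_simp
    rw [e, abs_div, Nat.abs_cast, div_le_iff₀ hm0]
    refine (abs_card_filter_mod_sub_le ha N).trans ?_
    rw [one_mul]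
    exact_mod_cast (by lia : 1 ≤ m)
  calc |(A : ℝ) - N / (d * m)| = |((A : ℝ) - A₀ / m) + (A₀ / m - N / (d * m))| := by congr 1; ring
    _ ≤ B + 1 := (abs_add_le _ _).trans (add_le_add h1 h2)

/-! ### The exponent -/

lemma ratio_bounds {q m : ℕ} (hq : 2 ≤ q) (hm : 2 ≤ m) :
    (q : ℝ) ≤ q * sin (π / (2 * m)) / sin (π / (2 * m * q)) ∧
      q * sin (π / (2 * m)) / sin (π / (2 * m * q)) < (q : ℝ) ^ 2 := by
  have hpi := pi_pos
  have hq2 : (2 : ℝ) ≤ q := by exact_mod_cast hq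
  have hm2 : (2 : ℝ) ≤ m := by exact_mod_cast hm
  set t := π / (2 * m * q) with ht
  have ht0 : 0 < t := by positivity
  have hqt : π / (2 * m) = q * t := by rw [ht]; field_simp
  have hqt2 : q * t ≤ π / 2 := by
    rw [← hqt]; gcongr; linarith
  have htt : t ≤ q * t := by nlinarith
  have hsin : 0 < sin t := sin_pos_of_pos_of_lt_pi ht0 (by linarith)
  rw [hqt]
  constructor
  · rw [le_div_iff₀ hsin]
    gcongr
    exact sin_le_sin_of_le_of_le_pi_div_two (by linarith) hqt2 htt
  · rw [div_lt_iff₀ hsin, pow_two, mul_assoc]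
    gcongr
    exact sin_nat_mul_lt ht0 hq hqt2

end Gelfond

open Gelfond in
/-- Gelfond's theorem: for `q, d, m ≥ 2`, `0 ≤ a < d`, `0 ≤ j < m` with
`gcd(m, q-1) = 1`, the count of `n < N` with `n ≡ a (mod d)` and
`s_q(n) ≡ j (mod m)` equals `N/(dm)` up to an error `O_q(N^λ)`, where
`λ = (1/(2 log q)) log (q sin(π/2m) / sin(π/2mq)) < 1`. -/
theorem gelfond_sum_of_digits (q : ℕ) (hq : 2 ≤ q) :
    ∃ C : ℝ, 0 < C ∧
      ∀ d m a j : ℕ, 2 ≤ d → 2 ≤ m → a < d → j < m → Nat.gcd m (q - 1) = 1 →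
        (1 / (2 * Real.log q)) *
            Real.log (q * Real.sin (π / (2 * m)) / Real.sin (π / (2 * m * q))) < 1 ∧
        ∀ N : ℕ, 1 ≤ N →
          |((((Finset.range N).filter
                (fun n => n % d = a ∧ (Nat.digits q n).sum % m = j)).card : ℝ)
              - (N : ℝ) / (d * m))| ≤
            C * (N : ℝ) ^
              ((1 / (2 * Real.log q)) *
                Real.log (q * Real.sin (π / (2 * m)) / Real.sin (π / (2 * m * q)))) := by
  refine ⟨2 * q ^ 2, by positivity, fun d m a j _ hm ha hj hgcd => ?_⟩
  have hq2 : (2 : ℝ) ≤ q := by exact_mod_cast hq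
  obtain ⟨hRq, hRlt⟩ := ratio_bounds hq hm
  set R := q * sin (π / (2 * m)) / sin (π / (2 * m * q))
  have hR0 : 0 < R := by linarith
  have hlogq : 0 < log q := log_pos (by linarith)
  set c := 1 / (2 * log q) * log R with hc
  have hcR : (q ^ 2 : ℝ) ^ c = R := by
    rw [rpow_def_of_pos (by positivity), log_pow, hc, Nat.cast_ofNat]
    have : 2 * log q * (1 / (2 * log q) * log R) = log R := by field_simp
    rw [this, exp_log hR0]
  have hc0 : 0 ≤ c := mul_nonneg (by positivity) (log_nonneg (by linarith))
  refine ⟨?_, fun N hN => ?_⟩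
  · rw [hc, one_div_mul_eq_div, div_lt_one (by positivity)]
    have := log_lt_log hR0 hRlt
    rwa [log_pow, Nat.cast_ofNat] at this
  · have hN1 : (1 : ℝ) ≤ (N : ℝ) ^ c := one_le_rpow (by exact_mod_cast hN) hc0
    have hq4 : (4 : ℝ) ≤ q ^ 2 := by nlinarith
    refine (abs_card_sub_le (B := 2 * q ^ 2 * (N : ℝ) ^ c - q ^ 2) ha hj
      (fun z w hz hz1 hw => ?_) (by nlinarith)).trans (by linarith)
    refine norm_digitSum_le hq hm hz (fun h => hz1 ?_) hc0 hcR.ge (by linarith) N hN w hw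
    rw [← orderOf_eq_one_iff, ← Nat.dvd_one, ← hgcd]
    exact Nat.dvd_gcd (orderOf_dvd_of_pow_eq_one hz) (orderOf_dvd_of_pow_eq_one h)
end

section
/- Let q ≥ 2, d ≥ 2 with d dividing q, and let a, j be integers with 0 ≤ a < d and 0 ≤ j < q. Define g(N) = #{0 ≤ n < N : n ≡ a (mod d) and s_q(n) ≡ j (mod q)} − N/(dq). Then g(N) = O(1) (there is a constant C with |g(N)| ≤ C for all N ≥ 1), and g(N) changes sign infinitely often: g(N) > 0 for infinitely many N and g(N) < 0 for infinitely many N. -/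
theorem Nat.sum_digits_mul_add {q r : ℕ} (hq : 2 ≤ q) (hr : r < q) (m : ℕ) :
    (Nat.digits q (q * m + r)).sum = r + (Nat.digits q m).sum := by
  rcases Nat.eq_zero_or_pos (q * m + r) with h | h
  · have hr0 : r = 0 := by omega
    have hm : m = 0 := by
      rcases Nat.mul_eq_zero.mp (show q * m = 0 by omega) with h | h <;> omega
    simp [hr0, hm]
  · rw [Nat.digits_def' (by omega) h, List.sum_cons, Nat.mul_add_mod, Nat.mod_eq_of_lt hr,
      Nat.mul_add_div (by omega), Nat.div_eq_of_lt hr, add_zero]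

theorem Nat.card_filter_range_mul_mod_eq {d a : ℕ} (ha : a < d) (e : ℕ) :
    ((Finset.range (d * e)).filter (fun r => r % d = a)).card = e := by
  conv_rhs => rw [← Finset.card_range e]
  refine Finset.card_bij' (fun r _ => r / d) (fun k _ => d * k + a) ?_ ?_ ?_ ?_
  · intro r hr
    simp only [Finset.mem_filter, Finset.mem_range] at hr ⊢
    exact Nat.div_lt_of_lt_mul hr.1
  · intro k hk
    simp only [Finset.mem_filter, Finset.mem_range] at hk ⊢
    refine ⟨?_, by rw [Nat.mul_add_mod, Nat.mod_eq_of_lt ha]⟩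
    have := Nat.mul_le_mul_left d (Nat.succ_le_of_lt hk)
    rw [Nat.mul_succ] at this
    omega
  · intro r hr
    simp only [Finset.mem_filter] at hr
    simpa [hr.2] using Nat.div_add_mod r d
  · intro k _
    simp [Nat.mul_add_div (by omega : 0 < d), Nat.div_eq_of_lt ha]

/-- Every block of `q ^ 2` consecutive integers starting at a multiple of `q ^ 2` contains exactly
`q / d` solutions. -/
theorem count_digitSum_block {q d a j : ℕ} (hq : 2 ≤ q) (hdq : d ∣ q) (ha : a < d) (hj : j < q)
    (K : ℕ) :
    Nat.count (fun i => (q * q * K + i) % d = a ∧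
      (Nat.digits q (q * q * K + i)).sum % q = j) (q * q) = q / d := by
  have hd : 0 < d := by omega
  have hmod (x r : ℕ) : (q * x + r) % d = r % d := by
    obtain ⟨e, rfl⟩ := hdq
    rw [mul_assoc, Nat.mul_add_mod]
  have hsum {m r : ℕ} (hm : m < q) (hr : r < q) :
      (Nat.digits q (q * q * K + (q * m + r))).sum = r + (m + (Nat.digits q K).sum) := by
    rw [show q * q * K + (q * m + r) = q * (q * K + m) + r by ring,
      Nat.sum_digits_mul_add hq hr, Nat.sum_digits_mul_add hq hm]
  have hres : ((Finset.range q).filter (fun r => r % d = a)).card = q / d := by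
    obtain ⟨e, rfl⟩ := hdq
    rw [Nat.card_filter_range_mul_mod_eq ha, Nat.mul_div_cancel_left _ hd]
  rw [Nat.count_eq_card_filter_range, ← hres]
  set t := (Nat.digits q K).sum
  refine Finset.card_bij' (fun i _ => i % q)
    (fun r _ => q * ((j + (q - 1) * (r + t)) % q) + r) ?_ ?_ ?_ ?_
  · intro i hi
    simp only [Finset.mem_filter, Finset.mem_range] at hi ⊢
    refine ⟨Nat.mod_lt _ (by omega), ?_⟩
    rw [Nat.mod_mod_of_dvd _ hdq, ← hi.2.1, mul_assoc, hmod]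
  · intro r hr
    simp only [Finset.mem_filter, Finset.mem_range] at hr ⊢
    have hm : (j + (q - 1) * (r + t)) % q < q := Nat.mod_lt _ (by omega)
    refine ⟨by nlinarith, ?_, ?_⟩
    · rw [mul_assoc, hmod, hmod, hr.2]
    · rw [hsum hm hr.1]
      obtain ⟨p, rfl⟩ : ∃ p, q = p + 1 := ⟨q - 1, by omega⟩
      rw [show r + ((j + (p + 1 - 1) * (r + t)) % (p + 1) + t)
          = (j + (p + 1 - 1) * (r + t)) % (p + 1) + (r + t) by ring, Nat.mod_add_mod,
        show j + (p + 1 - 1) * (r + t) + (r + t) = j + (p + 1) * (r + t) by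
          rw [Nat.add_sub_cancel]; ring, Nat.add_mul_mod_self_left, Nat.mod_eq_of_lt hj]
  · intro i hi
    simp only [Finset.mem_filter, Finset.mem_range] at hi
    have hm : i / q < q := Nat.div_lt_of_lt_mul hi.1
    have hr : i % q < q := Nat.mod_lt _ (by omega)
    have h := hi.2.2
    rw [← Nat.div_add_mod i q, hsum hm hr] at h
    have key : (j + (q - 1) * (i % q + t)) % q = i / q := by
      obtain ⟨p, rfl⟩ : ∃ p, q = p + 1 := ⟨q - 1, by omega⟩
      rw [← h, Nat.mod_add_mod, Nat.add_sub_cancel,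
        show i % (p + 1) + (i / (p + 1) + t) + p * (i % (p + 1) + t)
          = i / (p + 1) + (p + 1) * (i % (p + 1) + t) by ring,
        Nat.add_mul_mod_self_left, Nat.mod_eq_of_lt hm]
    simp only [key]
    exact Nat.div_add_mod i q
  · intro r hr
    simp only [Finset.mem_filter, Finset.mem_range] at hr
    simp only [Nat.mul_add_mod, Nat.mod_eq_of_lt hr.1]

theorem count_digitSum_mul {q d a j : ℕ} (hq : 2 ≤ q) (hdq : d ∣ q) (ha : a < d) (hj : j < q)
    (K : ℕ) :
    Nat.count (fun n => n % d = a ∧ (Nat.digits q n).sum % q = j) (q * q * K) = q / d * K := by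
  induction K with
  | zero => simp
  | succ K ih =>
    rw [Nat.mul_succ, Nat.count_add, ih, count_digitSum_block hq hdq ha hj, Nat.mul_succ]

theorem exists_lt_digitSum_mod_eq {q : ℕ} (hq : 2 ≤ q) (c M : ℕ) :
    ∃ K, M < K ∧ ((Nat.digits q K).sum + c) % q = 0 := by
  set t := (Nat.digits q (M + 1)).sum
  have hr : ((q - 1) * (t + c)) % q < q := Nat.mod_lt _ (by omega)
  refine ⟨q * (M + 1) + ((q - 1) * (t + c)) % q, by
    have := Nat.le_mul_of_pos_left (M + 1) (by omega : 0 < q)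
    omega, ?_⟩
  rw [Nat.sum_digits_mul_add hq hr, add_assoc, Nat.mod_add_mod]
  obtain ⟨p, rfl⟩ : ∃ p, q = p + 1 := ⟨q - 1, by omega⟩
  rw [Nat.add_sub_cancel, show p * (t + c) + (t + c) = (p + 1) * (t + c) by ring,
    Nat.mul_mod_right]

/-- Case `d ∣ q`: the error term `g(N)` is bounded and changes sign
infinitely often. -/
theorem dekking_case_d_dvd_q (q d : ℕ) (hq : 2 ≤ q) (hd : 2 ≤ d) (hdq : d ∣ q)
    (a j : ℕ) (ha : a < d) (hj : j < q) :
    (∃ C : ℝ, ∀ N : ℕ, 1 ≤ N →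
      |((((Finset.range N).filter
            (fun n => n % d = a ∧ (Nat.digits q n).sum % q = j)).card : ℝ)
          - (N : ℝ) / (d * q))| ≤ C) ∧
    (∀ M : ℕ, ∃ N : ℕ, M < N ∧
      0 < ((((Finset.range N).filter
            (fun n => n % d = a ∧ (Nat.digits q n).sum % q = j)).card : ℝ)
          - (N : ℝ) / (d * q))) ∧
    (∀ M : ℕ, ∃ N : ℕ, M < N ∧
      ((((Finset.range N).filter
            (fun n => n % d = a ∧ (Nat.digits q n).sum % q = j)).card : ℝ)
          - (N : ℝ) / (d * q)) < 0) := by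
  have hq0 : (0 : ℝ) < q := by exact_mod_cast (by omega : 0 < q)
  have hd0 : (0 : ℝ) < d := by exact_mod_cast (by omega : 0 < d)
  have hdq0 : (0 : ℝ) < d * q := mul_pos hd0 hq0
  have hdiv : ((q / d : ℕ) : ℝ) = q / d := Nat.cast_div hdq hd0.ne'
  have herr (K r : ℕ) :
      (q / d : ℕ) * (K : ℝ) - ((q * q * K + r : ℕ) : ℝ) / (d * q) = -(r / (d * q)) := by
    rw [hdiv]
    push_cast
    field_simp
    ring
  have hdigits (K r : ℕ) (hr : r < q) :
      (Nat.digits q (q * q * K + r)).sum = r + (Nat.digits q K).sum := by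
    rw [mul_assoc, Nat.sum_digits_mul_add hq hr]
    simpa using Nat.sum_digits_mul_add hq (by omega : 0 < q) K
  simp only [← Nat.count_eq_card_filter_range]
  refine ⟨⟨q * q, fun N _ => ?_⟩, fun M => ?_, fun M => ?_⟩
  · obtain ⟨K, r, hr, rfl⟩ : ∃ K r, r < q * q ∧ N = q * q * K + r :=
      ⟨N / (q * q), N % (q * q), Nat.mod_lt _ (by positivity), (Nat.div_add_mod _ _).symm⟩
    have h := herr K r
    rw [Nat.count_add, count_digitSum_mul hq hdq ha hj]
    have hc : ((Nat.count (fun i => (q * q * K + i) % d = a ∧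
        (Nat.digits q (q * q * K + i)).sum % q = j) r : ℕ) : ℝ) ≤ r := by
      exact_mod_cast Nat.count_le _
    have hr' : (r : ℝ) ≤ q * q := by exact_mod_cast hr.le
    have hdq1 : (1 : ℝ) ≤ d * q := by exact_mod_cast Nat.mul_pos (by omega) (by omega)
    have h0 : (0 : ℝ) ≤ r / (d * q) := by positivity
    have h1 : (r : ℝ) / (d * q) ≤ r := div_le_self (by positivity) hdq1
    have hc0 := Nat.cast_nonneg (α := ℝ) (Nat.count (fun i => (q * q * K + i) % d = a ∧
        (Nat.digits q (q * q * K + i)).sum % q = j) r)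
    rw [abs_le]
    push_cast at h ⊢
    constructor <;> linarith
  · obtain ⟨K, hK, hs⟩ := exists_lt_digitSum_mod_eq hq (a + (q - j)) M
    have haq : a < q := ha.trans_le (Nat.le_of_dvd (by omega) hdq)
    have hle := Nat.le_mul_of_pos_left K (by positivity : 0 < q * q)
    refine ⟨q * q * K + (a + 1), by omega, ?_⟩
    have h := herr K (a + 1)
    have hhit : (q * q * K + a) % d = a ∧ (Nat.digits q (q * q * K + a)).sum % q = j := by
      constructor
      · obtain ⟨e, rfl⟩ := hdq
        rw [mul_assoc, mul_assoc, Nat.mul_add_mod, Nat.mod_eq_of_lt ha]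
      · rw [hdigits K a haq]
        obtain ⟨x, hx⟩ := Nat.dvd_of_mod_eq_zero hs
        have hx' : a + (Nat.digits q K).sum + q = j + q * x := by omega
        rw [← Nat.add_mod_right, hx', Nat.add_mul_mod_self_left, Nat.mod_eq_of_lt hj]
    rw [← add_assoc, Nat.count_succ, if_pos hhit, Nat.count_add,
      count_digitSum_mul hq hdq ha hj]
    have hlt : ((a + 1 : ℕ) : ℝ) / (d * q) < 1 := by
      rw [div_lt_one hdq0]
      exact_mod_cast (by nlinarith : a + 1 < d * q)
    have hc0 := Nat.cast_nonneg (α := ℝ) (Nat.count (fun i => (q * q * K + i) % d = a ∧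
        (Nat.digits q (q * q * K + i)).sum % q = j) a)
    rw [← add_assoc] at h
    push_cast at h hlt ⊢
    linarith
  · obtain ⟨K, hK, hs⟩ := exists_lt_digitSum_mod_eq hq (q - j + 1) M
    have hle := Nat.le_mul_of_pos_left K (by positivity : 0 < q * q)
    refine ⟨q * q * K + 1, by omega, ?_⟩
    have h := herr K 1
    have hmiss : ¬ (q * q * K % d = a ∧ (Nat.digits q (q * q * K)).sum % q = j) := by
      rintro ⟨-, hsum⟩
      have h0 := hdigits K 0 (by omega)
      rw [add_zero, zero_add] at h0
      rw [h0] at hsum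
      rw [← Nat.mod_add_mod, hsum, show j + (q - j + 1) = q + 1 by omega,
        Nat.add_mod_left, Nat.mod_eq_of_lt (by omega)] at hs
      omega
    rw [Nat.count_succ, if_neg hmiss, count_digitSum_mul hq hdq ha hj]
    have hpos : (0 : ℝ) < 1 / (d * q) := by positivity
    push_cast at h ⊢
    linarith
end

section
/- Let q ≥ 2, d ≥ 2 with d dividing q−1, and let a, j be integers with 0 ≤ a < d and 0 ≤ j < q. Define g(N) = #{0 ≤ n < N : n ≡ a (mod d) and s_q(n) ≡ j (mod q)} − N/(dq). Then g(N) takes arbitrarily large positive values and arbitrarily large negative values as N → ∞: for every B > 0 there exists N with g(N) > B and there exists N with g(N) < −B. -/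
open Real Finset

/-- The kernel `∑_{r < q} cos ((2r - (q - 1)) x)`, equal to `sin (q x) / sin x`
where `sin x ≠ 0`. -/
noncomputable def digitKernel (q : ℕ) (x : ℝ) : ℝ :=
  ∑ r ∈ range q, cos ((2 * (r : ℝ) - ((q : ℝ) - 1)) * x)

lemma digitKernel_mul_sin (q : ℕ) (x : ℝ) : digitKernel q x * sin x = sin (q * x) := by
  have h := Finset.sum_range_sub (fun r : ℕ => sin ((2 * (r : ℝ) - q) * x)) q
  have h2 : ∀ r ∈ range q, sin ((2 * ((r + 1 : ℕ) : ℝ) - q) * x) - sin ((2 * (r : ℝ) - q) * x)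
      = 2 * (cos ((2 * (r : ℝ) - ((q : ℝ) - 1)) * x) * sin x) := by
    intro r _
    have e1 : (2 * ((r + 1 : ℕ) : ℝ) - q) * x = (2 * (r : ℝ) - ((q : ℝ) - 1)) * x + x := by
      push_cast; ring
    have e2 : (2 * (r : ℝ) - q) * x = (2 * (r : ℝ) - ((q : ℝ) - 1)) * x - x := by ring
    rw [e1, e2, sin_add, sin_sub]
    ring
  rw [Finset.sum_congr rfl h2, ← Finset.mul_sum, ← Finset.sum_mul] at h
  have e3 : (2 * (q : ℝ) - q) * x = q * x := by ring
  have e4 : (2 * ((0 : ℕ) : ℝ) - q) * x = -(q * x) := by push_cast; ring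
  simp only [e3, e4, sin_neg] at h
  unfold digitKernel
  linarith

lemma sum_sin_centered_eq_zero (q : ℕ) (x : ℝ) :
    ∑ r ∈ range q, sin ((2 * (r : ℝ) - ((q : ℝ) - 1)) * x) = 0 := by
  have h := Finset.sum_range_reflect (fun r : ℕ => sin ((2 * (r : ℝ) - ((q : ℝ) - 1)) * x)) q
  have h2 : ∀ r ∈ range q, sin ((2 * ((q - 1 - r : ℕ) : ℝ) - ((q : ℝ) - 1)) * x)
      = -sin ((2 * (r : ℝ) - ((q : ℝ) - 1)) * x) := by
    intro r hr
    have hr' := Finset.mem_range.mp hr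
    have : ((q - 1 - r : ℕ) : ℝ) = (q : ℝ) - 1 - r := by
      rw [Nat.cast_sub (by omega), Nat.cast_sub (by omega)]; simp
    rw [this, ← sin_neg]
    congr 1
    ring
  rw [Finset.sum_congr rfl h2, Finset.sum_neg_distrib] at h
  linarith

lemma sum_cos_shift (q : ℕ) (x y : ℝ) :
    ∑ r ∈ range q, cos (2 * (r : ℝ) * x + y) = cos (((q : ℝ) - 1) * x + y) * digitKernel q x := by
  have h : ∀ r ∈ range q, cos (2 * (r : ℝ) * x + y)
      = cos (((q : ℝ) - 1) * x + y) * cos ((2 * (r : ℝ) - ((q : ℝ) - 1)) * x)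
        - sin (((q : ℝ) - 1) * x + y) * sin ((2 * (r : ℝ) - ((q : ℝ) - 1)) * x) := by
    intro r _
    rw [← cos_add]
    congr 1
    ring
  rw [Finset.sum_congr rfl h, Finset.sum_sub_distrib, ← Finset.mul_sum, ← Finset.mul_sum,
    sum_sin_centered_eq_zero, mul_zero, sub_zero, digitKernel]

lemma sum_range_mul_eq (f : ℕ → ℝ) (q N : ℕ) :
    ∑ n ∈ range (N * q), f n = ∑ n ∈ range N, ∑ r ∈ range q, f (r + q * n) := by
  induction N with
  | zero => simp
  | succ N ih =>
    rw [Nat.succ_mul, Finset.sum_range_add, ih, Finset.sum_range_succ]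
    congr 1
    exact Finset.sum_congr rfl fun r _ => by congr 1; ring

lemma digits_sum_add_mul {q : ℕ} (hq : 2 ≤ q) (r n : ℕ) (hr : r < q) :
    (Nat.digits q (r + q * n)).sum = r + (Nat.digits q n).sum := by
  by_cases h : r = 0 ∧ n = 0
  · simp [h.1, h.2]
  · rw [Nat.digits_add q (by omega) r n hr (by tauto)]
    simp

lemma sum_cos_digits_sum {q : ℕ} (hq : 2 ≤ q) (k : ℕ) (x y : ℝ) :
    ∑ n ∈ range (q ^ k), cos (2 * ((Nat.digits q n).sum : ℝ) * x + y)
      = cos (k * ((q : ℝ) - 1) * x + y) * digitKernel q x ^ k := by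
  induction k generalizing y with
  | zero => simp
  | succ k ih =>
    rw [pow_succ, sum_range_mul_eq]
    have h : ∀ n ∈ range (q ^ k), ∑ r ∈ range q,
        cos (2 * ((Nat.digits q (r + q * n)).sum : ℝ) * x + y)
        = cos (2 * ((Nat.digits q n).sum : ℝ) * x + (((q : ℝ) - 1) * x + y))
          * digitKernel q x := by
      intro n _
      have h1 : ∀ r ∈ range q, cos (2 * ((Nat.digits q (r + q * n)).sum : ℝ) * x + y)
          = cos (2 * (r : ℝ) * x + (2 * ((Nat.digits q n).sum : ℝ) * x + y)) := by
        intro r hr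
        rw [digits_sum_add_mul hq r n (Finset.mem_range.mp hr)]
        congr 1
        push_cast
        ring
      rw [Finset.sum_congr rfl h1, sum_cos_shift]
      congr 2
      ring
    rw [Finset.sum_congr rfl h, ← Finset.sum_mul, ih, pow_succ, ← mul_assoc]
    congr 3
    push_cast
    ring

lemma sum_cos_orthogonality {m : ℕ} (hm : 0 < m) (u : ℤ) :
    ∑ t ∈ range m, cos (2 * (u : ℝ) * (π * t / m)) = if (m : ℤ) ∣ u then (m : ℝ) else 0 := by
  have hm' : (m : ℝ) ≠ 0 := by positivity
  split_ifs with hu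
  · obtain ⟨v, rfl⟩ := hu
    have h : ∀ t ∈ range m, cos (2 * (((m : ℤ) * v : ℤ) : ℝ) * (π * t / m)) = 1 := by
      intro t _
      rw [← Real.cos_int_mul_two_pi (v * t)]
      congr 1
      push_cast
      field_simp
    rw [Finset.sum_congr rfl h]
    simp
  · have hs : sin (π * u / m) ≠ 0 := by
      intro h0
      obtain ⟨n, hn⟩ := Real.sin_eq_zero_iff.mp h0
      apply hu
      refine ⟨n, ?_⟩
      have : (n : ℝ) * m = u := by
        field_simp at hn
        nlinarith [Real.pi_pos]
      have h2 : n * (m : ℤ) = u := by exact_mod_cast this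
      rw [← h2, mul_comm]
    have h := Finset.sum_range_sub (fun t : ℕ => sin ((2 * (t : ℝ) - 1) * (π * u / m))) m
    have h2 : ∀ t ∈ range m, sin ((2 * ((t + 1 : ℕ) : ℝ) - 1) * (π * u / m))
        - sin ((2 * (t : ℝ) - 1) * (π * u / m))
        = 2 * (cos (2 * (u : ℝ) * (π * t / m)) * sin (π * u / m)) := by
      intro t _
      have e1 : (2 * ((t + 1 : ℕ) : ℝ) - 1) * (π * u / m)
          = 2 * (u : ℝ) * (π * t / m) + π * u / m := by push_cast; ring
      have e2 : (2 * (t : ℝ) - 1) * (π * u / m)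
          = 2 * (u : ℝ) * (π * t / m) - π * u / m := by ring
      rw [e1, e2, sin_add, sin_sub]
      ring
    rw [Finset.sum_congr rfl h2, ← Finset.mul_sum, ← Finset.sum_mul] at h
    have e3 : (2 * (m : ℝ) - 1) * (π * u / m) = -(π * u / m) + u * (2 * π) := by
      field_simp
      ring
    have e4 : (2 * ((0 : ℕ) : ℝ) - 1) * (π * u / m) = -(π * u / m) := by push_cast; ring
    simp only [e3, e4, Real.sin_add_int_mul_two_pi, sub_self] at h
    have h5 := (mul_eq_zero.mp h).resolve_left two_ne_zero
    exact (mul_eq_zero.mp h5).resolve_right hs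

/-- The exponential sum over `n < q ^ k` attached to the angle `x` and the residue `c`. -/
noncomputable def digitWave (q c k : ℕ) (x : ℝ) : ℝ :=
  ∑ n ∈ range (q ^ k), cos (2 * ((((Nat.digits q n).sum : ℤ) - c : ℤ) : ℝ) * x)

lemma digitWave_eq {q : ℕ} (hq : 2 ≤ q) (c k : ℕ) (x : ℝ) :
    digitWave q c k x = cos ((k * ((q : ℝ) - 1) - 2 * c) * x) * digitKernel q x ^ k := by
  have h := sum_cos_digits_sum hq k x (-(2 * c * x))
  unfold digitWave
  convert h using 2
  · rename_i n _
    generalize (Nat.digits q n).sum = s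
    congr 1
    push_cast
    ring
  · congr 1
    ring

lemma digitWave_pi_sub (q c k : ℕ) (x : ℝ) :
    digitWave q c k (π - x) = digitWave q c k x := by
  unfold digitWave
  refine Finset.sum_congr rfl fun n _ => ?_
  generalize ((Nat.digits q n).sum : ℤ) - c = u
  rw [← Real.cos_int_mul_two_pi_sub (2 * (u : ℝ) * x) u]
  congr 1
  ring

lemma digitWave_zero (q c k : ℕ) : digitWave q c k 0 = (q : ℝ) ^ k := by
  simp [digitWave]

lemma mul_card_eq_sum_digitWave {m : ℕ} (hm : 0 < m) (q c k : ℕ) :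
    (m : ℝ) * ((range (q ^ k)).filter
        (fun n => (m : ℤ) ∣ ((Nat.digits q n).sum : ℤ) - c)).card
      = ∑ t ∈ range m, digitWave q c k (π * t / m) := by
  unfold digitWave
  rw [Finset.sum_comm, Finset.sum_congr rfl fun n _ => sum_cos_orthogonality hm _,
    ← Finset.sum_filter, Finset.sum_const, nsmul_eq_mul, mul_comm]

lemma abs_centered_le {q r : ℕ} (hr : r < q) :
    |2 * (r : ℝ) - ((q : ℝ) - 1)| ≤ q := by
  have h1 : (r : ℝ) + 1 ≤ q := by exact_mod_cast hr
  have h2 : (0 : ℝ) ≤ r := r.cast_nonneg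
  rw [abs_le]
  constructor <;> linarith

lemma digitKernel_strictAntiOn {q : ℕ} (hq : 2 ≤ q) :
    StrictAntiOn (digitKernel q) (Set.Icc 0 (π / q)) := by
  have hq0 : (0 : ℝ) < q := by positivity
  have key : ∀ x y : ℝ, 0 ≤ x → x < y → y ≤ π / q → ∀ r : ℕ, r < q →
      2 * (r : ℝ) - ((q : ℝ) - 1) ≠ 0 →
      cos ((2 * (r : ℝ) - ((q : ℝ) - 1)) * y) < cos ((2 * (r : ℝ) - ((q : ℝ) - 1)) * x) := by
    intro x y hx hxy hy r hr hne
    have hb := abs_centered_le hr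
    have hpos := abs_pos.mpr hne
    rw [← Real.cos_abs (_ * y), ← Real.cos_abs (_ * x), abs_mul, abs_mul, abs_of_nonneg hx,
      abs_of_nonneg (hx.trans hxy.le)]
    have hy' : y * q ≤ π := (le_div_iff₀ hq0).mp hy
    refine Real.cos_lt_cos_of_nonneg_of_le_pi (by positivity) ?_ ?_
    · nlinarith
    · exact mul_lt_mul_of_pos_left hxy hpos
  intro x hx y hy hxy
  refine Finset.sum_lt_sum ?_ ⟨0, Finset.mem_range.mpr (by omega), ?_⟩
  · intro r hr
    by_cases hne : 2 * (r : ℝ) - ((q : ℝ) - 1) = 0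
    · simp [hne]
    · exact (key x y hx.1 hxy hy.2 r (Finset.mem_range.mp hr) hne).le
  · refine key x y hx.1 hxy hy.2 0 (by omega) ?_
    have : (2 : ℝ) ≤ q := by exact_mod_cast hq
    push_cast
    intro h
    linarith

lemma exists_digitKernel_bound {q d : ℕ} (hq : 3 ≤ q) (hd : 2 ≤ d) :
    1 < digitKernel q (π / (d * q)) ∧ ∃ R : ℝ, 0 ≤ R ∧ R < digitKernel q (π / (d * q)) ∧
      ∀ x : ℝ, 2 * (π / (d * q)) ≤ x → x ≤ π / 2 → |digitKernel q x| ≤ R := by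
  have hpi := Real.pi_pos
  have hq3 : (3 : ℝ) ≤ q := by exact_mod_cast hq
  have hd2 : (2 : ℝ) ≤ d := by exact_mod_cast hd
  have hq0 : (0 : ℝ) < q := by linarith
  have hd0 : (0 : ℝ) < d := by linarith
  have hanti := digitKernel_strictAntiOn (q := q) (by omega)
  set x₁ := π / (d * q) with hx₁
  have hx₁0 : 0 < x₁ := by positivity
  have h2x₁ : 2 * x₁ ≤ π / q := by
    rw [hx₁, ← mul_div_assoc, div_le_div_iff₀ (by positivity) hq0]
    nlinarith [mul_pos hpi hq0]
  have hqpi : π / q ≤ π / 3 := div_le_div_of_nonneg_left hpi.le (by norm_num) hq3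
  have hqpos : 0 < π / q := by positivity
  have hhalf : π / q / 2 ∈ Set.Icc 0 (π / q) := ⟨by positivity, by linarith⟩
  have hs0 : 0 < sin (π / q / 2) := Real.sin_pos_of_pos_of_lt_pi (by positivity) (by linarith)
  have hsq0 : 0 < sin (π / q) := Real.sin_pos_of_pos_of_lt_pi (by positivity) (by linarith)
  have hslt : sin (π / q / 2) < sin (π / q) :=
    Real.sin_lt_sin_of_lt_of_le_pi_div_two (by linarith) (by linarith) (by linarith)
  have hhalf_eq : digitKernel q (π / q / 2) = 1 / sin (π / q / 2) := by
    rw [eq_div_iff hs0.ne', digitKernel_mul_sin]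
    have : (q : ℝ) * (π / q / 2) = π / 2 := by field_simp
    rw [this, Real.sin_pi_div_two]
  have hge : 1 / sin (π / q / 2) ≤ digitKernel q x₁ := by
    rw [← hhalf_eq]
    exact hanti.antitoneOn ⟨hx₁0.le, by linarith⟩ hhalf (by linarith)
  have hgt : 1 / sin (π / q) < digitKernel q x₁ :=
    (one_div_lt_one_div_of_lt hs0 hslt).trans_le hge
  refine ⟨((one_le_div hsq0).mpr (Real.sin_le_one _)).trans_lt hgt,
    max (digitKernel q (2 * x₁)) (1 / sin (π / q)), le_max_of_le_right (by positivity),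
    max_lt (hanti ⟨hx₁0.le, by linarith⟩ ⟨by linarith, h2x₁⟩ (by linarith)) hgt, ?_⟩
  intro x hx hx'
  have hxpos : 0 < x := by linarith
  have hsx : 0 < sin x := Real.sin_pos_of_pos_of_lt_pi hxpos (by linarith)
  have hmul := digitKernel_mul_sin q x
  rcases le_total x (π / q) with hxq | hxq
  · apply le_max_of_le_left
    have hnn : 0 ≤ digitKernel q x := by
      refine nonneg_of_mul_nonneg_left ?_ hsx
      rw [hmul]
      refine Real.sin_nonneg_of_nonneg_of_le_pi (by positivity) ?_
      rw [mul_comm]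
      exact (le_div_iff₀ hq0).mp hxq
    rw [abs_of_nonneg hnn]
    exact hanti.antitoneOn ⟨by linarith, h2x₁⟩ ⟨hxpos.le, hxq⟩ hx
  · apply le_max_of_le_right
    have hsle : sin (π / q) ≤ sin x :=
      Real.sin_le_sin_of_le_of_le_pi_div_two (by linarith) hx' hxq
    rw [le_div_iff₀ hsq0]
    calc |digitKernel q x| * sin (π / q) ≤ |digitKernel q x| * sin x := by gcongr
      _ = |sin (q * x)| := by rw [← hmul, abs_mul, abs_of_pos hsx]
      _ ≤ 1 := Real.abs_sin_le_one _

/-- The counting error at `N = q ^ k` is, up to lower order, a single oscillating wave. -/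
lemma exists_error_bound {q d : ℕ} (hq : 3 ≤ q) (hd : 2 ≤ d) (c : ℕ) :
    ∃ D R : ℝ, 1 < D ∧ 0 ≤ R ∧ R < D ∧ ∀ k : ℕ,
      |((d * q : ℕ) : ℝ) * ((range (q ^ k)).filter
          (fun n => ((d * q : ℕ) : ℤ) ∣ ((Nat.digits q n).sum : ℤ) - c)).card - (q : ℝ) ^ k
        - 2 * (cos ((k * ((q : ℝ) - 1) - 2 * c) * (π / (d * q))) * D ^ k)|
      ≤ (d * q : ℕ) * R ^ k := by
  obtain ⟨hD, R, hR0, hRD, hR⟩ := exists_digitKernel_bound hq hd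
  refine ⟨_, R, hD, hR0, hRD, fun k => ?_⟩
  have hpi := Real.pi_pos
  have hm : 6 ≤ d * q := by nlinarith
  rw [mul_card_eq_sum_digitWave (by omega), ← digitWave_eq (by omega)]
  have hcast : (d : ℝ) * q = ((d * q : ℕ) : ℝ) := by push_cast; ring
  rw [hcast] at hR ⊢
  obtain ⟨M, hM⟩ : ∃ M, d * q = M + 3 := ⟨d * q - 3, by omega⟩
  rw [hM] at hR ⊢
  have hM0 : (0 : ℝ) < ((M + 3 : ℕ) : ℝ) := by positivity
  set F : ℕ → ℝ := fun t => digitWave q c k (π * t / ((M + 3 : ℕ) : ℝ)) with hF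
  have hsymm : ∀ t, t ≤ M + 3 → F (M + 3 - t) = F t := by
    intro t ht
    simp only [hF]
    rw [← digitWave_pi_sub q c k (π * t / ((M + 3 : ℕ) : ℝ))]
    congr 1
    rw [Nat.cast_sub ht]
    field_simp
  have hsmall : ∀ t : ℕ, 2 ≤ t → 2 * t ≤ M + 3 → |F t| ≤ R ^ k := by
    intro t h2 ht
    have h2' : (2 : ℝ) ≤ t := by exact_mod_cast h2
    have ht' : 2 * (t : ℝ) ≤ ((M + 3 : ℕ) : ℝ) := by exact_mod_cast ht
    have hb : |digitKernel q (π * t / ((M + 3 : ℕ) : ℝ))| ≤ R := by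
      apply hR
      · rw [← mul_div_assoc]
        gcongr ?_ / _
        nlinarith
      · rw [div_le_div_iff₀ hM0 two_pos]
        nlinarith
    rw [hF]
    simp only
    rw [digitWave_eq (by omega), abs_mul, abs_pow]
    calc _ ≤ 1 * R ^ k := by
          gcongr
          exact Real.abs_cos_le_one _
      _ = R ^ k := one_mul _
  have hmid : ∀ i ∈ range M, |F (i + 2)| ≤ R ^ k := by
    intro i hi
    have hi' := Finset.mem_range.mp hi
    rcases le_total (2 * (i + 2)) (M + 3) with h | h
    · exact hsmall _ (by omega) h
    · rw [← hsymm _ (by omega)]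
      exact hsmall _ (by omega) (by omega)
  have hF0 : F 0 = (q : ℝ) ^ k := by simp [hF, digitWave_zero]
  have hF1 : F 1 = digitWave q c k (π / ((M + 3 : ℕ) : ℝ)) := by simp [hF]
  have hF2 : F (M + 2) = F 1 := by
    rw [← hsymm 1 (by omega)]
    rfl
  have hsum : ∑ t ∈ range (M + 3), F t = F 0 + 2 * F 1 + ∑ i ∈ range M, F (i + 2) := by
    rw [Finset.sum_range_succ, Finset.sum_range_succ', Finset.sum_range_succ', hF2]
    ring
  change |∑ t ∈ range (M + 3), F t - _ - _| ≤ _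
  rw [hsum, ← hF1, ← hF0]
  have : F 0 + 2 * F 1 + ∑ i ∈ range M, F (i + 2) - F 0 - 2 * F 1
      = ∑ i ∈ range M, F (i + 2) := by ring
  rw [this]
  calc |∑ i ∈ range M, F (i + 2)| ≤ ∑ i ∈ range M, |F (i + 2)| := Finset.abs_sum_le_sum_abs _ _
    _ ≤ ∑ _i ∈ range M, R ^ k := Finset.sum_le_sum hmid
    _ = M * R ^ k := by simp
    _ ≤ ((M + 3 : ℕ) : ℝ) * R ^ k := by
      gcongr
      omega

lemma exists_nat_mul_sub_mem_Ioo {δ : ℝ} (hδ : 0 < δ) (hδ' : δ < π) (β φ : ℝ) :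
    ∃ (k : ℕ) (L : ℤ), k * δ - β - L * (2 * π) - φ ∈ Set.Ioo (-(π / 2)) (π / 2) := by
  have hpi := Real.pi_pos
  obtain ⟨L, hL⟩ := exists_nat_ge ((π / 2 - φ - β) / (2 * π))
  rw [div_le_iff₀ (by positivity)] at hL
  have hT : 0 ≤ (L * (2 * π) + φ - π / 2 + β) / δ := div_nonneg (by linarith) hδ.le
  have h1 := Nat.floor_le hT
  have h2 := Nat.lt_floor_add_one ((L * (2 * π) + φ - π / 2 + β) / δ)
  rw [le_div_iff₀ hδ] at h1
  rw [div_lt_iff₀ hδ] at h2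
  refine ⟨⌊(L * (2 * π) + φ - π / 2 + β) / δ⌋₊ + 1, L, ?_, ?_⟩ <;> push_cast <;> linarith

lemma exists_cos_pos {δ : ℝ} (hδ : 0 < δ) (hδ' : δ < π) (β φ : ℝ) :
    ∃ k : ℕ, 0 < cos (k * δ - β - φ) := by
  obtain ⟨k, L, h⟩ := exists_nat_mul_sub_mem_Ioo hδ hδ' β φ
  refine ⟨k, ?_⟩
  rw [← Real.cos_sub_int_mul_two_pi _ L]
  convert Real.cos_pos_of_mem_Ioo h using 2
  ring

lemma exists_large_dominant {D R γ : ℝ} (hD : 1 < D) (hR : 0 ≤ R) (hRD : R < D) (hγ : 0 < γ)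
    (A C : ℝ) : ∃ K : ℕ, ∀ k ≥ K, C < 2 * (γ * D ^ k) - A * R ^ k := by
  have hD0 : 0 < D := by linarith
  have h1 : Filter.Tendsto (fun k : ℕ => A * (R / D) ^ k) Filter.atTop (nhds (A * 0)) :=
    (tendsto_pow_atTop_nhds_zero_of_lt_one (by positivity)
      ((div_lt_one hD0).mpr hRD)).const_mul A
  rw [mul_zero] at h1
  have h2 := (tendsto_pow_atTop_atTop_of_one_lt hD).eventually_gt_atTop (C / γ)
  obtain ⟨K, hK⟩ := Filter.eventually_atTop.mp ((h1.eventually_lt_const hγ).and h2)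
  refine ⟨K, fun k hk => ?_⟩
  obtain ⟨h3, h4⟩ := hK k hk
  rw [div_lt_iff₀ hγ] at h4
  have hDk : 0 < D ^ k := by positivity
  rw [div_pow, ← mul_div_assoc, div_lt_iff₀ hDk] at h3
  linarith

/-- On powers of `q`, the counting error exceeds any bound with either prescribed sign `ε`. -/
lemma exists_signed_error_gt {q d : ℕ} (hq : 3 ≤ q) (hd : 2 ≤ d) (c : ℕ) {ε : ℝ}
    (hε : ε = 1 ∨ ε = -1) (C : ℝ) :
    ∃ k : ℕ, C < ε * (((d * q : ℕ) : ℝ) * ((range (q ^ k)).filter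
          (fun n => ((d * q : ℕ) : ℤ) ∣ ((Nat.digits q n).sum : ℤ) - c)).card
        - (q : ℝ) ^ k) := by
  obtain ⟨D, R, hD, hR0, hRD, hbound⟩ := exists_error_bound hq hd c
  have hpi := Real.pi_pos
  have hq3 : (3 : ℝ) ≤ q := by exact_mod_cast hq
  have hd2 : (2 : ℝ) ≤ d := by exact_mod_cast hd
  have hd0 : (0 : ℝ) < d := by linarith
  have hq0 : (0 : ℝ) < q := by linarith
  have hm0 : (0 : ℝ) < d * q := by positivity
  have hδ : 0 < ((q : ℝ) - 1) * (π / (d * q)) := mul_pos (by linarith) (by positivity)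
  have hδ' : ((q : ℝ) - 1) * (π / (d * q)) < π := by
    rw [← mul_div_assoc, div_lt_iff₀ hm0]
    nlinarith [mul_pos hpi hq0]
  have hsign : ∃ k₀ : ℕ, 0 < ε * cos ((k₀ * ((q : ℝ) - 1) - 2 * c) * (π / (d * q))) := by
    rcases hε with rfl | rfl
    · obtain ⟨k, hk⟩ := exists_cos_pos hδ hδ' (2 * c * (π / (d * q))) 0
      refine ⟨k, ?_⟩
      rw [one_mul]
      convert hk using 2
      ring
    · obtain ⟨k, hk⟩ := exists_cos_pos hδ hδ' (2 * c * (π / (d * q))) π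
      rw [Real.cos_sub_pi] at hk
      refine ⟨k, ?_⟩
      have e : ((k : ℝ) * ((q : ℝ) - 1) - 2 * c) * (π / (d * q))
          = k * (((q : ℝ) - 1) * (π / (d * q))) - 2 * c * (π / (d * q)) := by ring
      rwa [neg_one_mul, e]
  obtain ⟨k₀, hk₀⟩ := hsign
  obtain ⟨K, hK⟩ := exists_large_dominant hD hR0 hRD hk₀ (d * q : ℕ) C
  have hm1 : 1 ≤ d * q := by nlinarith
  refine ⟨k₀ + 2 * (d * q) * K, ?_⟩
  have hlarge := hK (k₀ + 2 * (d * q) * K) (by nlinarith)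
  have hb := hbound (k₀ + 2 * (d * q) * K)
  have hper : cos ((((k₀ + 2 * (d * q) * K : ℕ) : ℝ) * ((q : ℝ) - 1) - 2 * c) * (π / (d * q)))
      = cos ((k₀ * ((q : ℝ) - 1) - 2 * c) * (π / (d * q))) := by
    rw [← Real.cos_add_int_mul_two_pi ((k₀ * ((q : ℝ) - 1) - 2 * c) * (π / (d * q))) ((K : ℤ) * ((q : ℤ) - 1))]
    congr 1
    push_cast
    field_simp
    ring
  rw [hper] at hb
  have hb' := abs_le.mp hb
  rcases hε with rfl | rfl <;> linarith

lemma mod_and_digits_sum_mod_iff {q d : ℕ} (hq : 2 ≤ q) (hd : 2 ≤ d) (hdq : d ∣ q - 1)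
    {a j : ℕ} (ha : a < d) (hj : j < q) :
    ∃ c : ℕ, ∀ n : ℕ, (n % d = a ∧ (Nat.digits q n).sum % q = j) ↔
      ((d * q : ℕ) : ℤ) ∣ ((Nat.digits q n).sum : ℤ) - c := by
  have hqd : q % d = 1 := by
    obtain ⟨e, he⟩ := hdq
    have : q = 1 + d * e := by omega
    rw [this, Nat.add_mul_mod_self_left, Nat.mod_eq_of_lt (by omega)]
  have hcop : Nat.Coprime d q := by
    rw [Nat.coprime_comm, Nat.Coprime, Nat.gcd_comm, Nat.gcd_rec, hqd, Nat.gcd_one_left]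
  obtain ⟨c, hca, hcj⟩ := Nat.chineseRemainder hcop a j
  refine ⟨c, fun n => ?_⟩
  have hn := Nat.modEq_digits_sum d q hqd n
  rw [← Nat.modEq_iff_dvd, ← Nat.modEq_and_modEq_iff_modEq_mul hcop]
  constructor
  · rintro ⟨h1, h2⟩
    refine ⟨hca.trans (Nat.ModEq.trans ?_ hn), hcj.trans ?_⟩
    · rw [Nat.ModEq, h1, Nat.mod_eq_of_lt ha]
    · rw [Nat.ModEq, h2, Nat.mod_eq_of_lt hj]
  · rintro ⟨h1, h2⟩
    constructor
    · rw [(hn.trans (h1.symm.trans hca) : n % d = a % d), Nat.mod_eq_of_lt ha]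
    · rw [(h2.symm.trans hcj : _ % q = j % q), Nat.mod_eq_of_lt hj]

/-- Case `d ∣ q - 1`: the error term `g(N)` takes arbitrarily large positive
values and arbitrarily large negative values. -/
theorem dekking_case_d_dvd_q_sub_one (q d : ℕ) (hq : 2 ≤ q) (hd : 2 ≤ d)
    (hdq : d ∣ q - 1) (a j : ℕ) (ha : a < d) (hj : j < q) :
    ∀ B : ℝ, 0 < B →
      (∃ N : ℕ,
        B < ((((Finset.range N).filter
              (fun n => n % d = a ∧ (Nat.digits q n).sum % q = j)).card : ℝ)
            - (N : ℝ) / (d * q))) ∧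
      (∃ N : ℕ,
        ((((Finset.range N).filter
              (fun n => n % d = a ∧ (Nat.digits q n).sum % q = j)).card : ℝ)
            - (N : ℝ) / (d * q)) < -B) := by
  intro B _
  have hq3 : 3 ≤ q := by
    have := Nat.le_of_dvd (by omega) hdq
    omega
  obtain ⟨c, hc⟩ := mod_and_digits_sum_mod_iff hq hd hdq ha hj
  have hm0 : (0 : ℝ) < d * q := by
    have : 0 < d * q := by positivity
    exact_mod_cast this
  simp only [hc]
  constructor
  · obtain ⟨k, hk⟩ := exists_signed_error_gt hq3 hd c (Or.inl rfl) (B * (d * q))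
    refine ⟨q ^ k, ?_⟩
    rw [← mul_lt_mul_iff_left₀ hm0, sub_mul, Nat.cast_pow, div_mul_cancel₀ _ hm0.ne']
    simp only [Nat.cast_mul] at hk ⊢
    linarith
  · obtain ⟨k, hk⟩ := exists_signed_error_gt hq3 hd c (Or.inr rfl) (B * (d * q))
    refine ⟨q ^ k, ?_⟩
    rw [← mul_lt_mul_iff_left₀ hm0, sub_mul, Nat.cast_pow, div_mul_cancel₀ _ hm0.ne']
    simp only [Nat.cast_mul] at hk ⊢
    linarith
end

section
/- (Dekking's conjecture.) Let q ≥ 2 and let j be an integer with 0 ≤ j < q. Then the quantity #{0 ≤ n < N : s_q(2n) ≡ j (mod q)} − N/q is strictly positive for infinitely many N and strictly negative for infinitely many N. -/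
open Finset Polynomial

theorem digits_sum_mul_add {q : ℕ} (hq : 2 ≤ q) (m : ℕ) {d : ℕ} (hd : d < q) :
    (Nat.digits q (q * m + d)).sum = (Nat.digits q m).sum + d := by
  by_cases h : d ≠ 0 ∨ m ≠ 0
  · rw [add_comm (q * m), Nat.digits_add q (by omega) d m hd h, List.sum_cons, add_comm]
  · push Not at h
    simp [h.1, h.2]

/-- A sum over `range (q * M)` splits into sums over blocks of length `q`. -/
theorem sum_range_mul_eq_sum_sum {R : Type*} [AddCommMonoid R] (q M : ℕ) (F : ℕ → R) :
    ∑ n ∈ range (q * M), F n = ∑ m ∈ range M, ∑ d ∈ range q, F (q * m + d) := by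
  induction M with
  | zero => simp
  | succ M ih => rw [Nat.mul_succ, sum_range_add, ih, sum_range_succ]

/-- Discrete Fourier expansion of the discrepancy of a sequence in the residue class `j`. -/
theorem mul_card_filter_sub_eq_sum {q : ℕ} {ζ : ℂ} (hζ : IsPrimitiveRoot ζ q) {j : ℕ}
    (hj : j < q) (u : ℕ → ℕ) (N : ℕ) :
    (q : ℂ) * ((range N).filter (fun n => u n % q = j)).card - N =
      ∑ l ∈ Ico 1 q, (ζ ^ l) ^ (q - j) * ∑ n ∈ range N, (ζ ^ l) ^ u n := by
  have key (a : ℕ) : ∑ l ∈ range q, (ζ ^ (a + (q - j))) ^ l = if a % q = j then (q : ℂ) else 0 := by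
    have hiff : a % q = j ↔ q ∣ a + (q - j) := by
      have := Nat.div_add_mod a q
      have := Nat.mod_lt a (by omega : 0 < q)
      constructor
      · intro h
        exact ⟨a / q + 1, by rw [mul_add]; omega⟩
      · intro h
        have h2 : a + (q - j) ≡ j + (q - j) [MOD q] := by
          rw [Nat.add_sub_cancel' hj.le]
          exact (Nat.modEq_zero_iff_dvd.2 h).trans (Nat.modEq_zero_iff_dvd.2 dvd_rfl).symm
        have h3 := Nat.ModEq.add_right_cancel' _ h2
        rwa [Nat.ModEq, Nat.mod_eq_of_lt hj] at h3
    by_cases h : a % q = j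
    · rw [if_pos h, (hζ.pow_eq_one_iff_dvd _).2 (hiff.1 h)]
      simp
    · rw [if_neg h]
      have hne : ζ ^ (a + (q - j)) ≠ 1 := fun h1 => h (hiff.2 ((hζ.pow_eq_one_iff_dvd _).1 h1))
      have h2 := geom_sum_mul (ζ ^ (a + (q - j))) q
      rw [← pow_mul, mul_comm _ q, pow_mul, hζ.pow_eq_one, one_pow, sub_self] at h2
      exact (mul_eq_zero.1 h2).resolve_right (sub_ne_zero.2 hne)
  have total : ∑ l ∈ range q, (ζ ^ l) ^ (q - j) * ∑ n ∈ range N, (ζ ^ l) ^ u n =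
      (q : ℂ) * ((range N).filter (fun n => u n % q = j)).card := by
    simp_rw [mul_sum]
    rw [sum_comm, card_filter, Nat.cast_sum, mul_sum]
    refine sum_congr rfl fun n _ => ?_
    rw [Nat.cast_ite, mul_ite, Nat.cast_one, Nat.cast_zero, mul_one, mul_zero, ← key]
    refine sum_congr rfl fun l _ => ?_
    rw [← pow_add, ← pow_mul, ← pow_mul, mul_comm l, add_comm (u n)]
  rw [← total, range_eq_Ico, sum_eq_sum_Ico_succ_bot (by omega : 0 < q)]
  simp

/-- A nonzero exponential sum whose frequencies are annihilated by real polynomials with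
nonnegative coefficients and positive constant term is negative infinitely often. -/
theorem exists_exponential_sum_neg {ι : Type*} [DecidableEq ι] {s : Finset ι} (hs : s.Nonempty)
    {μ c : ι → ℂ} (hinj : Set.InjOn μ s) (hμ : ∀ l ∈ s, μ l ≠ 0) (hc : ∀ l ∈ s, c l ≠ 0)
    (G : ι → ℝ[X]) (hG : ∀ l ∈ s, ∀ i, 0 ≤ (G l).coeff i) (hG0 : ∀ l ∈ s, 0 < (G l).coeff 0)
    (hroot : ∀ l ∈ s, aeval (μ l) (G l) = 0)
    {f : ℕ → ℝ} (hf : ∀ k, (f k : ℂ) = ∑ l ∈ s, c l * μ l ^ k) (K : ℕ) :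
    ∃ k, K ≤ k ∧ f k < 0 := by
  by_contra! hpos
  have shift (p : ℂ[X]) (k : ℕ) : ∑ i ∈ range (p.natDegree + 1), p.coeff i * (f (k + i) : ℂ) =
      ∑ l ∈ s, c l * μ l ^ k * p.eval (μ l) := by
    simp_rw [hf, eval_eq_sum_range, mul_sum]
    rw [sum_comm]
    exact sum_congr rfl fun l _ => sum_congr rfl fun i _ => by ring
  set P : ℝ[X] := ∏ l ∈ s, G l with hP
  have hPnonneg (i : ℕ) : 0 ≤ P.coeff i := by
    refine prod_induction G (fun p => ∀ i, 0 ≤ p.coeff i) ?_ ?_ hG i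
    · intro a b ha hb i
      rw [coeff_mul]
      exact sum_nonneg fun x _ => mul_nonneg (ha _) (hb _)
    · intro i
      rw [coeff_one]
      split_ifs <;> norm_num
  have hP0 : 0 < P.coeff 0 := by
    rw [hP, coeff_zero_prod]
    exact prod_pos hG0
  have hzero (k : ℕ) (hk : K ≤ k) : f k = 0 := by
    have h1 := shift (P.map (algebraMap ℝ ℂ)) k
    rw [sum_eq_zero (s := s)] at h1
    · have h2 : ∑ i ∈ range (P.natDegree + 1), P.coeff i * f (k + i) = 0 := by
        rw [natDegree_map] at h1
        simp only [coeff_map, Complex.coe_algebraMap] at h1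
        exact_mod_cast h1
      have h3 := (sum_eq_zero_iff_of_nonneg fun i _ =>
        mul_nonneg (hPnonneg i) (hpos (k + i) (by omega))).1 h2 0 (by simp)
      exact (mul_eq_zero.1 h3).resolve_left hP0.ne'
    · intro l hl
      rw [eval_map_algebraMap, hP, map_prod, prod_eq_zero hl (hroot l hl), mul_zero]
  obtain ⟨l₀, hl₀⟩ := hs
  have h := shift (∏ l ∈ s.erase l₀, (X - C (μ l))) K
  rw [sum_eq_zero fun i _ => by rw [hzero _ (by omega)]; simp, sum_eq_single_of_mem l₀ hl₀] at h
  · refine absurd h.symm (mul_ne_zero (mul_ne_zero (hc _ hl₀) (pow_ne_zero _ (hμ _ hl₀))) ?_)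
    rw [eval_prod, prod_ne_zero_iff]
    intro l hl
    rw [eval_sub, eval_X, eval_C, sub_ne_zero]
    exact fun h => (mem_erase.1 hl).1 (hinj hl₀ (mem_erase.1 hl).2 h).symm
  · intro l hl hne
    rw [eval_prod, prod_eq_zero (mem_erase.2 ⟨hne, hl⟩) (by simp), mul_zero]

/-- For `z ^ m = ‖z‖ ^ m` with `z` not a nonnegative real, `∑ ‖z‖ ^ (m - 1 - i) X ^ i` is a
polynomial with nonnegative coefficients vanishing at `z`. -/
theorem exists_polynomial_nonneg_coeff {z : ℂ} {m : ℕ} (hm : 0 < m) (hz : z ^ m = (‖z‖ : ℂ) ^ m)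
    (hne : z ≠ ‖z‖) :
    ∃ G : ℝ[X], (∀ i, 0 ≤ G.coeff i) ∧ 0 < G.coeff 0 ∧ aeval z G = 0 := by
  have hz0 : z ≠ 0 := by
    rintro rfl
    simp at hne
  have hcoeff (i : ℕ) : (∑ i ∈ range m, C (‖z‖ ^ (m - 1 - i)) * X ^ i : ℝ[X]).coeff i =
      if i < m then ‖z‖ ^ (m - 1 - i) else 0 := by
    simp only [finsetSum_coeff, coeff_C_mul, coeff_X_pow, mul_ite, mul_one, mul_zero,
      sum_ite_eq, mem_range]
  refine ⟨∑ i ∈ range m, C (‖z‖ ^ (m - 1 - i)) * X ^ i, fun i => ?_, ?_, ?_⟩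
  · rw [hcoeff]
    split_ifs <;> positivity
  · rw [hcoeff, if_pos hm]
    have := norm_pos_iff.2 hz0
    positivity
  · have h := (Commute.all z (‖z‖ : ℂ)).geom_sum₂_mul m
    rw [hz, sub_self] at h
    have h2 := (mul_eq_zero.1 h).resolve_right (sub_ne_zero.2 hne)
    simp only [map_sum, map_mul, aeval_C, map_pow, aeval_X, Complex.coe_algebraMap]
    rw [← h2]
    exact sum_congr rfl fun i _ => mul_comm _ _

theorem one_add_ne_zero_of_odd_pow_eq_one {q : ℕ} (hodd : Odd q) {ω : ℂ} (hω : ω ^ q = 1) :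
    1 + ω ≠ 0 := by
  intro h
  rw [eq_neg_of_add_eq_zero_right h, hodd.neg_one_pow] at hω
  norm_num at hω

theorem two_div_one_add_root_pow {q : ℕ} (hodd : Odd q) {ω : ℂ} (hω : ω ^ q = 1) (hω1 : ω ≠ 1) :
    (2 / (1 + ω)) ^ (2 * q) = (‖2 / (1 + ω)‖ : ℂ) ^ (2 * q) ∧
      2 / (1 + ω) ≠ (‖2 / (1 + ω)‖ : ℂ) := by
  have h1 := one_add_ne_zero_of_odd_pow_eq_one hodd hω
  have hω0 : ω ≠ 0 := by
    rintro rfl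
    rw [zero_pow hodd.pos.ne'] at hω
    norm_num at hω
  have hnorm : ‖ω‖ = 1 := Complex.norm_eq_one_of_pow_eq_one hω hodd.pos.ne'
  have hconj : (starRingEnd ℂ) (2 / (1 + ω)) = ω * (2 / (1 + ω)) := by
    have h2 : (starRingEnd ℂ) ω = ω⁻¹ := (Complex.inv_eq_conj hnorm).symm
    have h3 : 1 + ω⁻¹ ≠ 0 := by
      intro h
      apply h1
      field_simp at h
      linear_combination h
    rw [map_div₀, map_add, h2, map_one, map_ofNat, ← mul_div_assoc, div_eq_div_iff h3 h1]
    field_simp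
    ring
  set z := 2 / (1 + ω) with hz
  have hz0 : z ≠ 0 := div_ne_zero two_ne_zero h1
  constructor
  · have h2 := Complex.mul_conj' z
    rw [hconj] at h2
    rw [pow_mul (‖z‖ : ℂ), ← h2, mul_pow, mul_pow, hω]
    ring
  · intro h
    rw [h, Complex.conj_ofReal, ← h] at hconj
    exact hω1 (mul_right_cancel₀ hz0 (by rw [one_mul, ← hconj]))

theorem sum_range_pow_mul_pow_digits_sum {q : ℕ} (hq : 2 ≤ q) {ε : ℂ} (hε : ε ^ q = ε) (ω : ℂ)
    (M : ℕ) :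
    ∑ n ∈ range (q * M), ε ^ n * ω ^ (Nat.digits q n).sum =
      (∑ d ∈ range q, (ε * ω) ^ d) * ∑ n ∈ range M, ε ^ n * ω ^ (Nat.digits q n).sum := by
  rw [sum_range_mul_eq_sum_sum, mul_sum]
  refine sum_congr rfl fun m _ => ?_
  rw [sum_mul]
  refine sum_congr rfl fun d hd => ?_
  rw [digits_sum_mul_add hq m (mem_range.1 hd), pow_add, pow_mul, hε, pow_add, mul_pow]
  ring

theorem geom_sum_eq_zero_of_pow_eq_one {q : ℕ} {ω : ℂ} (hω : ω ^ q = 1) (hω1 : ω ≠ 1) :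
    ∑ d ∈ range q, ω ^ d = 0 := by
  have h := geom_sum_mul ω q
  rw [hω, sub_self] at h
  exact (mul_eq_zero.1 h).resolve_right (sub_ne_zero.2 hω1)

theorem sum_pow_digits_sum_two_mul_of_odd {q : ℕ} (hq : 2 ≤ q) (hodd : Odd q) {ω : ℂ}
    (hω : ω ^ q = 1) (hω1 : ω ≠ 1) (k : ℕ) :
    ∑ n ∈ range (q ^ (k + 1)), ω ^ (Nat.digits q (2 * n)).sum =
      (1 - ω) / (1 + ω) * (2 / (1 + ω)) ^ k := by
  have h1 := one_add_ne_zero_of_odd_pow_eq_one hodd hω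
  have even_odd (N : ℕ) : 2 * ∑ n ∈ range N, ω ^ (Nat.digits q (2 * n)).sum =
      ∑ n ∈ range (2 * N), (1 : ℂ) ^ n * ω ^ (Nat.digits q n).sum +
      ∑ n ∈ range (2 * N), (-1 : ℂ) ^ n * ω ^ (Nat.digits q n).sum := by
    rw [sum_range_mul_eq_sum_sum, sum_range_mul_eq_sum_sum, ← sum_add_distrib, mul_sum]
    refine sum_congr rfl fun n _ => ?_
    simp only [sum_range_succ, range_zero, sum_empty, pow_add, pow_mul]
    norm_num
    ring
  have hgeom : ∑ d ∈ range q, (-1 * ω) ^ d = 2 / (1 + ω) := by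
    have h := geom_sum_mul (-1 * ω) q
    rw [mul_pow, hodd.neg_one_pow, hω] at h
    rw [eq_div_iff h1]
    linear_combination -h
  have alt (k : ℕ) : ∑ n ∈ range (2 * q ^ k), (-1 : ℂ) ^ n * ω ^ (Nat.digits q n).sum =
      (1 - ω) * (2 / (1 + ω)) ^ k := by
    induction k with
    | zero =>
      have := Nat.digits_of_lt q 1 one_ne_zero (by omega)
      simp [sum_range_succ, this, sub_eq_add_neg]
    | succ k ih =>
      rw [show 2 * q ^ (k + 1) = q * (2 * q ^ k) by ring,
        sum_range_pow_mul_pow_digits_sum hq hodd.neg_one_pow, ih, hgeom]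
      ring
  have h := even_odd (q ^ (k + 1))
  rw [alt, show 2 * q ^ (k + 1) = q * (2 * q ^ k) by ring,
    sum_range_pow_mul_pow_digits_sum hq (one_pow q), one_mul,
    geom_sum_eq_zero_of_pow_eq_one hω hω1] at h
  rw [pow_succ (2 / (1 + ω)), zero_mul, zero_add] at h
  linear_combination h / 2

theorem exists_discrepancy_neg_pos_of_odd {q : ℕ} (hq : 2 ≤ q) (hodd : Odd q) {j : ℕ} (hj : j < q)
    (M : ℕ) :
    (∃ N : ℕ, M < N ∧ (q : ℝ) *
      ((range N).filter (fun n => (Nat.digits q (2 * n)).sum % q = j)).card - N < 0) ∧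
    (∃ N : ℕ, M < N ∧ 0 < (q : ℝ) *
      ((range N).filter (fun n => (Nat.digits q (2 * n)).sum % q = j)).card - N) := by
  classical
  have hζ := Complex.isPrimitiveRoot_exp q (by omega)
  set ζ := Complex.exp (2 * Real.pi * Complex.I / q)
  set f : ℕ → ℝ := fun k => (q : ℝ) * ((range (q ^ (k + 1))).filter
    (fun n => (Nat.digits q (2 * n)).sum % q = j)).card - (q ^ (k + 1) : ℕ) with hf
  set c : ℕ → ℂ := fun l => (ζ ^ l) ^ (q - j) * ((1 - ζ ^ l) / (1 + ζ ^ l)) with hc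
  set μ : ℕ → ℂ := fun l => 2 / (1 + ζ ^ l) with hμ
  have hpow (l : ℕ) : (ζ ^ l) ^ q = 1 := by
    rw [← pow_mul, mul_comm, pow_mul, hζ.pow_eq_one, one_pow]
  have hadd (l : ℕ) : 1 + ζ ^ l ≠ 0 := one_add_ne_zero_of_odd_pow_eq_one hodd (hpow l)
  have hone (l : ℕ) (hl : l ∈ Ico 1 q) : ζ ^ l ≠ 1 := by
    rw [mem_Ico] at hl
    exact hζ.pow_ne_one_of_pos_of_lt (by omega) hl.2
  have hfc (k : ℕ) : (f k : ℂ) = ∑ l ∈ Ico 1 q, c l * μ l ^ k := by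
    have h := mul_card_filter_sub_eq_sum hζ hj (fun n => (Nat.digits q (2 * n)).sum) (q ^ (k + 1))
    simp only [hf, Complex.ofReal_sub, Complex.ofReal_mul, Complex.ofReal_natCast]
    rw [h]
    refine sum_congr rfl fun l hl => ?_
    rw [sum_pow_digits_sum_two_mul_of_odd hq hodd (hpow l) (hone l hl), ← mul_assoc]
  have hne : (Ico 1 q).Nonempty := ⟨1, by simp; omega⟩
  have hinj : Set.InjOn μ (Ico 1 q : Finset ℕ) := by
    intro a ha b hb hab
    simp only [coe_Ico, Set.mem_Ico] at ha hb
    simp only [hμ] at hab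
    rw [div_eq_div_iff (hadd a) (hadd b)] at hab
    exact hζ.pow_inj ha.2 hb.2 (by linear_combination -hab / 2)
  have hμ0 : ∀ l ∈ Ico 1 q, μ l ≠ 0 := fun l _ => div_ne_zero two_ne_zero (hadd l)
  have hc0 : ∀ l ∈ Ico 1 q, c l ≠ 0 := fun l hl =>
    mul_ne_zero (pow_ne_zero _ (pow_ne_zero _ (hζ.ne_zero (by omega))))
      (div_ne_zero (sub_ne_zero.2 (hone l hl).symm) (hadd l))
  have hG : ∀ l, ∃ G : ℝ[X], l ∈ Ico 1 q →
      (∀ i, 0 ≤ G.coeff i) ∧ 0 < G.coeff 0 ∧ aeval (μ l) G = 0 := by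
    intro l
    by_cases hl : l ∈ Ico 1 q
    · obtain ⟨h1, h2⟩ := two_div_one_add_root_pow hodd (hpow l) (hone l hl)
      obtain ⟨G, hG⟩ := exists_polynomial_nonneg_coeff (by omega : 0 < 2 * q) h1 h2
      exact ⟨G, fun _ => hG⟩
    · exact ⟨0, fun h => absurd h hl⟩
  choose G hG using hG
  have hlarge (k : ℕ) (hk : M ≤ k) : M < q ^ (k + 1) :=
    (Nat.lt_pow_self (by omega)).trans_le (Nat.pow_le_pow_right (by omega) (by omega))
  constructor
  · obtain ⟨k, hk, hneg⟩ := exists_exponential_sum_neg hne hinj hμ0 hc0 G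
      (fun l hl => (hG l hl).1) (fun l hl => (hG l hl).2.1) (fun l hl => (hG l hl).2.2) hfc M
    exact ⟨q ^ (k + 1), hlarge k hk, hneg⟩
  · obtain ⟨k, hk, hneg⟩ := exists_exponential_sum_neg (c := fun l => -c l) (f := fun k => -f k)
      hne hinj hμ0 (fun l hl => neg_ne_zero.2 (hc0 l hl)) G
      (fun l hl => (hG l hl).1) (fun l hl => (hG l hl).2.1) (fun l hl => (hG l hl).2.2)
      (fun k => by rw [Complex.ofReal_neg, hfc, ← sum_neg_distrib]; simp) M
    exact ⟨q ^ (k + 1), hlarge k hk, neg_lt_zero.1 hneg⟩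

theorem sum_pow_digits_sum_two_mul_of_even {q : ℕ} (hq : 2 ≤ q) (heven : Even q) {ω : ℂ}
    (hω : ω ^ q = 1) (hω1 : ω ≠ 1) (m : ℕ) :
    ∑ n ∈ range (q * m), ω ^ (Nat.digits q (2 * n)).sum = 0 := by
  obtain ⟨h, rfl⟩ := heven
  rw [sum_range_mul_eq_sum_sum]
  refine sum_eq_zero fun n _ => ?_
  have hgeom := geom_sum_eq_zero_of_pow_eq_one hω hω1
  rw [← two_mul h, sum_range_mul_eq_sum_sum] at hgeom
  have hsucc : (Nat.digits (h + h) (2 * n + 1)).sum = (Nat.digits (h + h) (2 * n)).sum + 1 := by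
    have hn := Nat.div_add_mod (2 * n) (h + h)
    have hlt := Nat.mod_lt (2 * n) (by omega : 0 < h + h)
    have hdvd : 2 ∣ 2 * n % (h + h) :=
      (Nat.dvd_mod_iff ⟨h, by ring⟩).2 (dvd_mul_right 2 n)
    rw [← hn, add_assoc, digits_sum_mul_add hq _ (by omega : _ + 1 < h + h),
      digits_sum_mul_add hq _ hlt, add_assoc]
  rw [sum_range_add, ← sum_add_distrib]
  have hblock : ∀ r ∈ range h,
      ω ^ (Nat.digits (h + h) (2 * ((h + h) * n + r))).sum +
        ω ^ (Nat.digits (h + h) (2 * ((h + h) * n + (h + r)))).sum =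
      ω ^ (Nat.digits (h + h) (2 * n)).sum * ∑ d ∈ range 2, ω ^ (2 * r + d) := by
    intro r hr
    rw [mem_range] at hr
    rw [show 2 * ((h + h) * n + r) = (h + h) * (2 * n) + 2 * r by ring,
      show 2 * ((h + h) * n + (h + r)) = (h + h) * (2 * n + 1) + 2 * r by ring,
      digits_sum_mul_add hq _ (by omega), digits_sum_mul_add hq _ (by omega), hsucc]
    simp only [sum_range_succ, range_zero, sum_empty, pow_add]
    ring
  rw [sum_congr rfl hblock, ← mul_sum, hgeom, mul_zero]

theorem card_filter_digits_sum_two_mul_of_even {q : ℕ} (hq : 2 ≤ q) (heven : Even q) {j : ℕ}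
    (hj : j < q) (m : ℕ) :
    ((range (q * m)).filter (fun n => (Nat.digits q (2 * n)).sum % q = j)).card = m := by
  have hζ := Complex.isPrimitiveRoot_exp q (by omega)
  have h := mul_card_filter_sub_eq_sum hζ hj (fun n => (Nat.digits q (2 * n)).sum) (q * m)
  rw [sum_eq_zero, sub_eq_zero] at h
  · exact Nat.eq_of_mul_eq_mul_left (by omega : 0 < q) (by exact_mod_cast h)
  · intro l hl
    rw [mem_Ico] at hl
    rw [sum_pow_digits_sum_two_mul_of_even hq heven _
      (hζ.pow_ne_one_of_pos_of_lt (by omega) hl.2), mul_zero]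
    rw [← pow_mul, mul_comm l q, pow_mul, hζ.pow_eq_one, one_pow]

theorem exists_digits_sum_two_mul_mod_eq_of_even {q : ℕ} (hq : 2 ≤ q) (heven : Even q) {j : ℕ}
    (hj : j < q) (M : ℕ) : ∃ n, M ≤ n ∧ (Nat.digits q (2 * n)).sum % q = j := by
  by_contra! h
  have h1 := card_filter_digits_sum_two_mul_of_even hq heven hj (M + 1)
  have h2 : (range (q * (M + 1))).filter (fun n => (Nat.digits q (2 * n)).sum % q = j) ⊆
      range M := by
    intro n hn
    rw [mem_range]
    by_contra hlt
    exact h n (by omega) (mem_filter.1 hn).2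
  have h3 := card_le_card h2
  rw [h1, card_range] at h3
  omega

theorem exists_discrepancy_neg_pos_of_even {q : ℕ} (hq : 2 ≤ q) (heven : Even q) {j : ℕ}
    (hj : j < q) (M : ℕ) :
    (∃ N : ℕ, M < N ∧ (q : ℝ) *
      ((range N).filter (fun n => (Nat.digits q (2 * n)).sum % q = j)).card - N < 0) ∧
    (∃ N : ℕ, M < N ∧ 0 < (q : ℝ) *
      ((range N).filter (fun n => (Nat.digits q (2 * n)).sum % q = j)).card - N) := by
  have hcard (n : ℕ) : ((range (q * n + 1)).filter
      (fun n => (Nat.digits q (2 * n)).sum % q = j)).card =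
      n + if (Nat.digits q (2 * n)).sum % q = j then 1 else 0 := by
    have hdig : (Nat.digits q (2 * (q * n))).sum = (Nat.digits q (2 * n)).sum := by
      rw [show 2 * (q * n) = q * (2 * n) + 0 by ring, digits_sum_mul_add hq _ (by omega), add_zero]
    rw [range_add_one, filter_insert, hdig]
    split_ifs
    · rw [card_insert_of_notMem (by simp), card_filter_digits_sum_two_mul_of_even hq heven hj]
    · rw [card_filter_digits_sum_two_mul_of_even hq heven hj, add_zero]
  have hlarge (n : ℕ) (hn : M ≤ n) : M < q * n + 1 := by nlinarith
  have hq' : (2 : ℝ) ≤ q := by exact_mod_cast hq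
  constructor
  · obtain ⟨i, hi, hij⟩ : ∃ i, i < q ∧ i ≠ j := by
      by_cases h : j = 0
      · exact ⟨1, by omega, by omega⟩
      · exact ⟨0, by omega, by omega⟩
    obtain ⟨n, hn, hnj⟩ := exists_digits_sum_two_mul_mod_eq_of_even hq heven hi M
    refine ⟨q * n + 1, hlarge n hn, ?_⟩
    rw [hcard, if_neg (by omega)]
    push_cast
    linarith
  · obtain ⟨n, hn, hnj⟩ := exists_digits_sum_two_mul_mod_eq_of_even hq heven hj M
    refine ⟨q * n + 1, hlarge n hn, ?_⟩
    rw [hcard, if_pos hnj]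
    push_cast
    linarith

/-- Dekking's conjecture: for `q ≥ 2` and `0 ≤ j < q`, the quantity
`#{0 ≤ n < N : s_q(2n) ≡ j (mod q)} − N/q` is strictly positive for
infinitely many `N` and strictly negative for infinitely many `N`. -/
theorem dekking_conjecture (q : ℕ) (hq : 2 ≤ q) (j : ℕ) (hj : j < q) :
    (∀ M : ℕ, ∃ N : ℕ, M < N ∧
      0 < ((((Finset.range N).filter
            (fun n => (Nat.digits q (2 * n)).sum % q = j)).card : ℝ)
          - (N : ℝ) / q)) ∧
    (∀ M : ℕ, ∃ N : ℕ, M < N ∧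
      ((((Finset.range N).filter
            (fun n => (Nat.digits q (2 * n)).sum % q = j)).card : ℝ)
          - (N : ℝ) / q) < 0) := by
  have hq0 : (0 : ℝ) < q := by exact_mod_cast (by omega : 0 < q)
  have hscale (a b : ℝ) : a - b / q = (q * a - b) / q := by field_simp
  have main := fun M => (Nat.even_or_odd q).elim
    (fun h => exists_discrepancy_neg_pos_of_even hq h hj M)
    (fun h => exists_discrepancy_neg_pos_of_odd hq h hj M)
  constructor <;> intro M
  · obtain ⟨N, hN, h⟩ := (main M).2
    exact ⟨N, hN, by rw [hscale]; exact div_pos h hq0⟩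
  · obtain ⟨N, hN, h⟩ := (main M).1
    exact ⟨N, hN, by rw [hscale]; exact div_neg_of_neg_of_pos h hq0⟩
end

section
/- Let q, d ≥ 2 be coprime integers. Let ω, ω' be q-th roots of unity with ω ≠ 1, ω' ≠ 1, and let ε, ε' be d-th roots of unity with ε ≠ 1, ε' ≠ 1 (so that automatically ωε ≠ 1 and ω'ε' ≠ 1). If (1−ε)/(1−ωε) = (1−ε')/(1−ω'ε'), then ω = ω' and ε = ε'. In other words, the complex numbers (1−ε)/(1−ωε), as (ω, ε) ranges over such pairs, are pairwise distinct. -/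
open ComplexConjugate in
/-- Conjugation inverts points of the unit circle, so it multiplies `(1 - ε) / (1 - ω * ε)`
by `ω`. -/
theorem conj_one_sub_div_one_sub_mul {ω ε : ℂ} (hω : ‖ω‖ = 1) (hε : ‖ε‖ = 1)
    (h : ω * ε ≠ 1) :
    conj ((1 - ε) / (1 - ω * ε)) = ω * ((1 - ε) / (1 - ω * ε)) := by
  have hω0 : ω ≠ 0 := norm_ne_zero_iff.mp (by simp [hω])
  have hε0 : ε ≠ 0 := norm_ne_zero_iff.mp (by simp [hε])
  have h1 : 1 - ω * ε ≠ 0 := sub_ne_zero.mpr h.symm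
  have h2 : 1 - ω⁻¹ * ε⁻¹ ≠ 0 := by
    rw [← mul_inv]
    exact sub_ne_zero.mpr fun e => h (inv_eq_one.mp e.symm)
  simp only [map_div₀, map_sub, map_mul, map_one, ← Complex.inv_eq_conj hω,
    ← Complex.inv_eq_conj hε]
  rw [← mul_div_assoc, div_eq_div_iff h2 h1]
  field_simp
  ring

/-- Roots of unity of coprime orders have product `1` only if they are trivial. -/
theorem mul_ne_one_of_pow_eq_one_of_coprime {M : Type*} [CommMonoid M] {q d : ℕ}
    (hqd : Nat.Coprime q d) {ω ε : M} (hω : ω ^ q = 1) (hω1 : ω ≠ 1) (hε : ε ^ d = 1) :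
    ω * ε ≠ 1 := by
  intro h
  have hd : ω ^ d = 1 := by simpa [mul_pow, hε] using congrArg (· ^ d) h
  have : orderOf ω ∣ Nat.gcd q d :=
    Nat.dvd_gcd (orderOf_dvd_of_pow_eq_one hω) (orderOf_dvd_of_pow_eq_one hd)
  rw [hqd.gcd_eq_one, Nat.dvd_one, orderOf_eq_one_iff] at this
  exact hω1 this

/-- For coprime `q, d ≥ 2`, the numbers `(1−ε)/(1−ωε)` (with `ω` a nontrivial
`q`-th root of unity and `ε` a nontrivial `d`-th root of unity) are pairwise
distinct. -/
theorem ratios_pairwise_distinct (q d : ℕ) (hq : 2 ≤ q) (hd : 2 ≤ d)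
    (hqd : Nat.Coprime q d) (ω ω' ε ε' : ℂ)
    (hω : ω ^ q = 1) (hω1 : ω ≠ 1) (hω' : ω' ^ q = 1) (hω'1 : ω' ≠ 1)
    (hε : ε ^ d = 1) (hε1 : ε ≠ 1) (hε' : ε' ^ d = 1) (hε'1 : ε' ≠ 1)
    (h : (1 - ε) / (1 - ω * ε) = (1 - ε') / (1 - ω' * ε')) :
    ω = ω' ∧ ε = ε' := by
  have hq0 : q ≠ 0 := by omega
  have hd0 : d ≠ 0 := by omega
  have hωε := mul_ne_one_of_pow_eq_one_of_coprime hqd hω hω1 hε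
  have hωε' := mul_ne_one_of_pow_eq_one_of_coprime hqd hω' hω'1 hε'
  have hc := conj_one_sub_div_one_sub_mul (Complex.norm_eq_one_of_pow_eq_one hω hq0)
    (Complex.norm_eq_one_of_pow_eq_one hε hd0) hωε
  have hc' := conj_one_sub_div_one_sub_mul (Complex.norm_eq_one_of_pow_eq_one hω' hq0)
    (Complex.norm_eq_one_of_pow_eq_one hε' hd0) hωε'
  rw [← h, hc] at hc'
  have hD : 1 - ω * ε ≠ 0 := sub_ne_zero.mpr hωε.symm
  have hD' : 1 - ω' * ε' ≠ 0 := sub_ne_zero.mpr hωε'.symm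
  have hωω' : ω = ω' := mul_right_cancel₀ (div_ne_zero (sub_ne_zero.mpr hε1.symm) hD) hc'
  subst hωω'
  refine ⟨rfl, ?_⟩
  rw [div_eq_div_iff hD hD'] at h
  exact mul_left_cancel₀ (sub_ne_zero.mpr hω1) (by linear_combination h)
end

section
/- Let q ≥ 2 and d ≥ 2 with d dividing q, and let a, j be integers with 0 < a < d and 0 ≤ j < q. Then for every integer N ≥ 0 with N ≡ a (mod q^2), one has #{0 ≤ n < N : n ≡ a (mod d) and s_q(n) ≡ j (mod q)} = (N − a)/(dq); equivalently, the error g(N) = #{0 ≤ n < N : n ≡ a (mod d), s_q(n) ≡ j (mod q)} − N/(dq) equals −a/(dq) < 0 for all such N. -/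
theorem Nat.sum_digits_eq_mod_add_sum_digits_div {q : ℕ} (hq : 2 ≤ q) (n : ℕ) :
    (Nat.digits q n).sum = n % q + (Nat.digits q (n / q)).sum := by
  rcases Nat.eq_zero_or_pos n with rfl | hn
  · simp
  · rw [Nat.digits_def' hq hn, List.sum_cons]

theorem Nat.sum_digits_sq_mul_add {q : ℕ} (hq : 2 ≤ q) (m : ℕ) {r : ℕ} (hr : r < q ^ 2) :
    (Nat.digits q (q ^ 2 * m + r)).sum = (Nat.digits q m).sum + r / q + r % q := by
  have hq0 : 0 < q := by omega
  have hrq : r / q < q := Nat.div_lt_of_lt_mul (by rwa [← sq])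
  have e : q ^ 2 * m + r = r + q * (q * m) := by ring
  rw [Nat.sum_digits_eq_mod_add_sum_digits_div hq, e, Nat.add_mul_mod_self_left,
    Nat.add_mul_div_left _ _ hq0, Nat.sum_digits_eq_mod_add_sum_digits_div hq,
    Nat.add_mul_mod_self_left, Nat.add_mul_div_left _ _ hq0, Nat.mod_eq_of_lt hrq,
    Nat.div_eq_of_lt hrq, Nat.zero_add]
  ring

/-- Among the two-digit blocks in base `d * c`, those in a given residue class modulo `d` and with
a given (shifted) digit sum modulo `d * c` are determined by the quotient by `d` of the last
digit. -/
theorem Nat.count_two_digit_block {d c a j : ℕ} (ha : a < d) (hj : j < d * c) (s : ℕ) :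
    Nat.count (fun r => r % d = a ∧ (s + r / (d * c) + r % (d * c)) % (d * c) = j)
      ((d * c) ^ 2) = c := by
  have hq0 : 0 < d * c := by omega
  have hd0 : 0 < d := by omega
  rw [Nat.count_eq_card_filter_range]
  conv_rhs => rw [← Finset.card_range c]
  refine Finset.card_bij (fun r _ => r % (d * c) / d) ?_ ?_ ?_
  · intro r _
    exact Finset.mem_range.2 (Nat.div_lt_of_lt_mul (Nat.mod_lt _ hq0))
  · intro r hr t ht h
    simp only [Finset.mem_filter, Finset.mem_range] at hr ht
    obtain ⟨hr, hra, hrj⟩ := hr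
    obtain ⟨ht, hta, htj⟩ := ht
    have hlow : r % (d * c) = t % (d * c) := by
      rw [← Nat.div_add_mod (r % (d * c)) d, ← Nat.div_add_mod (t % (d * c)) d, h,
        Nat.mod_mul_right_mod, Nat.mod_mul_right_mod, hra, hta]
    have hhigh : r / (d * c) ≡ t / (d * c) [MOD d * c] := by
      have h1 : s + r / (d * c) + r % (d * c) ≡ s + t / (d * c) + r % (d * c) [MOD d * c] := by
        rw [← hlow] at htj
        exact hrj.trans htj.symm
      exact Nat.ModEq.add_left_cancel' s (Nat.ModEq.add_right_cancel' _ h1)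
    have hhigh' := hhigh.eq_of_lt_of_lt (Nat.div_lt_of_lt_mul (by rwa [← sq]))
      (Nat.div_lt_of_lt_mul (by rwa [← sq]))
    rw [← Nat.div_add_mod r (d * c), ← Nat.div_add_mod t (d * c), hlow, hhigh']
  · intro k hk
    have hk : k + 1 ≤ c := Finset.mem_range.1 hk
    have hlow : a + d * k < d * c := by nlinarith
    obtain ⟨e, he, hej⟩ : ∃ e < d * c, (s + e + (a + d * k)) % (d * c) = j := by
      have hm := Nat.mod_lt (s + (a + d * k)) hq0
      refine ⟨(j + (d * c - (s + (a + d * k)) % (d * c))) % (d * c), Nat.mod_lt _ hq0, ?_⟩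
      have e1 : s + (j + (d * c - (s + (a + d * k)) % (d * c))) % (d * c) + (a + d * k) =
        (s + (a + d * k)) + (j + (d * c - (s + (a + d * k)) % (d * c))) % (d * c) := by ring
      rw [e1, Nat.add_mod_mod, ← Nat.mod_add_mod]
      have e2 : (s + (a + d * k)) % (d * c) + (j + (d * c - (s + (a + d * k)) % (d * c))) =
        j + d * c := by omega
      rw [e2, Nat.add_mod_right, Nat.mod_eq_of_lt hj]
    have hmod : (a + d * k + d * c * e) % (d * c) = a + d * k := by
      rw [Nat.add_mul_mod_self_left, Nat.mod_eq_of_lt hlow]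
    have hdiv : (a + d * k + d * c * e) / (d * c) = e := by
      rw [Nat.add_mul_div_left _ _ hq0, Nat.div_eq_of_lt hlow, Nat.zero_add]
    refine ⟨a + d * k + d * c * e, ?_, ?_⟩
    · simp only [Finset.mem_filter, Finset.mem_range]
      refine ⟨by nlinarith, ?_, by rw [hmod, hdiv, hej]⟩
      rw [mul_assoc, Nat.add_mul_mod_self_left, Nat.add_mul_mod_self_left, Nat.mod_eq_of_lt ha]
    · simp only [hmod]
      rw [Nat.add_mul_div_left _ _ hd0, Nat.div_eq_of_lt ha, Nat.zero_add]

theorem Nat.count_mod_and_sum_digits {d c a j : ℕ} (hq : 2 ≤ d * c) (ha : a < d)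
    (hj : j < d * c) (m : ℕ) :
    Nat.count (fun n => n % d = a ∧ (Nat.digits (d * c) n).sum % (d * c) = j)
      ((d * c) ^ 2 * m + a) = m * c := by
  have hdvd (m r : ℕ) : ((d * c) ^ 2 * m + r) % d = r % d := by
    have e : (d * c) ^ 2 * m + r = r + d * (d * c ^ 2 * m) := by ring
    rw [e, Nat.add_mul_mod_self_left]
  have hblocks : Nat.count (fun n => n % d = a ∧ (Nat.digits (d * c) n).sum % (d * c) = j)
      ((d * c) ^ 2 * m) = m * c := by
    induction m with
    | zero => simp
    | succ m ih =>
      rw [Nat.mul_succ, Nat.count_add, ih, Nat.succ_mul]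
      congr 1
      refine Eq.trans ?_ (Nat.count_two_digit_block ha hj (Nat.digits (d * c) m).sum)
      rw [Nat.count_eq_card_filter_range, Nat.count_eq_card_filter_range]
      congr 1
      refine Finset.filter_congr fun r hr => ?_
      rw [hdvd, Nat.sum_digits_sq_mul_add hq m (Finset.mem_range.1 hr)]
  rw [Nat.count_add, hblocks, Nat.count_eq_card_filter_range, Finset.filter_false_of_mem]
  · simp
  · intro r hr
    have hr := Finset.mem_range.1 hr
    rw [hdvd, Nat.mod_eq_of_lt (hr.trans ha)]
    omega

/-- Case `d ∣ q`, `0 < a < d`: for `N ≡ a (mod q²)` the count equals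
`(N − a)/(dq)` exactly, i.e. the error `g(N)` equals `−a/(dq) < 0`. -/
theorem error_along_special_N (q d : ℕ) (hq : 2 ≤ q) (hd : 2 ≤ d) (hdq : d ∣ q)
    (a j : ℕ) (ha0 : 0 < a) (ha : a < d) (hj : j < q) :
    ∀ N : ℕ, N % q ^ 2 = a →
      ((((Finset.range N).filter
            (fun n => n % d = a ∧ (Nat.digits q n).sum % q = j)).card : ℚ) =
          ((N : ℚ) - a) / (d * q)) ∧
      ((((Finset.range N).filter
            (fun n => n % d = a ∧ (Nat.digits q n).sum % q = j)).card : ℚ)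
          - (N : ℚ) / (d * q) = -(a : ℚ) / (d * q)) ∧
      (-(a : ℚ) / (d * q) < 0) := by
  intro N hN
  obtain ⟨c, rfl⟩ := hdq
  have hc : (c : ℚ) ≠ 0 := by
    rintro h
    simp [Nat.cast_eq_zero.1 h] at hq
  have hd0 : (d : ℚ) ≠ 0 := by
    have : d ≠ 0 := by omega
    exact_mod_cast this
  have hcount := Nat.count_mod_and_sum_digits hq ha hj (N / (d * c) ^ 2)
  have hNeq := Nat.div_add_mod N ((d * c) ^ 2)
  rw [hN] at hNeq
  rw [hNeq, Nat.count_eq_card_filter_range] at hcount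
  rw [hcount]
  have hNQ : (N : ℚ) = ((d : ℚ) * c) ^ 2 * ((N / (d * c) ^ 2 : ℕ) : ℚ) + a := by
    exact_mod_cast hNeq.symm
  generalize N / (d * c) ^ 2 = m at hNQ
  refine ⟨?_, ?_, ?_⟩
  · rw [hNQ]
    push_cast
    field_simp
    ring
  · rw [hNQ]
    push_cast
    field_simp
    ring
  · have ha' : (0 : ℚ) < a := by exact_mod_cast ha0
    have : (0 : ℚ) < d * (d * c : ℕ) := by
      have : 0 < d * (d * c) := by positivity
      exact_mod_cast this
    exact div_neg_of_neg_of_pos (neg_neg_of_pos ha') this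
end
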